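/- (Auxiliary 2D Korn-type inequality with mixed term) There is an absolute constant C₀ (one can take C₀ = 100) such that: for any p > 0, h ∈ (0,1), α ∈ [−1,1], and any vector field φ = (u,v) ∈ H¹(I_h × [0,p]; ℝ²) satisfying u(x,0) = u(x,p) in the sense of traces, one has ‖G_α‖² ≤ C₀ ‖e_α‖ ( ‖u‖/h + ‖e_α‖ ), where G_α = [[u_x, u_y],[v_x, v_y + αu]] and e_α = (G_α + G_αᵀ)/2. -/

import Mathlib

open Real MeasureTheory

noncomputable section

/-- x-partial derivative of a function on ℝ². -/
def dx (f : ℝ × ℝ → ℝ) (q : ℝ × ℝ) : ℝ := fderiv ℝ f q (1, 0)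

/-- y-partial derivative of a function on ℝ². -/
def dy (f : ℝ × ℝ → ℝ) (q : ℝ × ℝ) : ℝ := fderiv ℝ f q (0, 1)

/-- The interval I_h = [1-h/2, 1+h/2]. -/
def Ih (h : ℝ) : Set ℝ := Set.Icc (1 - h/2) (1 + h/2)

/-- The rectangle I_h × [0,p]. -/
def rect (h p : ℝ) : Set (ℝ × ℝ) := Ih h ×ˢ Set.Icc 0 p

section Calculus

lemma hasDerivAt_dx {f : ℝ × ℝ → ℝ} (hf : ContDiff ℝ (⊤ : ℕ∞) f) (x y : ℝ) :
    HasDerivAt (fun t => f (t, y)) (dx f (x, y)) x :=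
  ((hf.differentiable (by simp)) (x, y)).hasFDerivAt.comp_hasDerivAt x
    ((hasDerivAt_id x).prodMk (hasDerivAt_const x y))

lemma hasDerivAt_dy {f : ℝ × ℝ → ℝ} (hf : ContDiff ℝ (⊤ : ℕ∞) f) (x y : ℝ) :
    HasDerivAt (fun t => f (x, t)) (dy f (x, y)) y :=
  ((hf.differentiable (by simp)) (x, y)).hasFDerivAt.comp_hasDerivAt y
    ((hasDerivAt_const y x).prodMk (hasDerivAt_id y))

lemma dx_eq_of_hasDerivAt {f : ℝ × ℝ → ℝ} (hf : ContDiff ℝ (⊤ : ℕ∞) f) {x y d : ℝ}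
    (h : HasDerivAt (fun t => f (t, y)) d x) : dx f (x, y) = d :=
  (hasDerivAt_dx hf x y).unique h

lemma dy_eq_of_hasDerivAt {f : ℝ × ℝ → ℝ} (hf : ContDiff ℝ (⊤ : ℕ∞) f) {x y d : ℝ}
    (h : HasDerivAt (fun t => f (x, t)) d y) : dy f (x, y) = d :=
  (hasDerivAt_dy hf x y).unique h

lemma contDiff_dx {f : ℝ × ℝ → ℝ} (hf : ContDiff ℝ (⊤ : ℕ∞) f) :
    ContDiff ℝ (⊤ : ℕ∞) (dx f) :=
  (hf.fderiv_right (m := (⊤ : ℕ∞)) (by simp)).clm_apply contDiff_const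

lemma contDiff_dy {f : ℝ × ℝ → ℝ} (hf : ContDiff ℝ (⊤ : ℕ∞) f) :
    ContDiff ℝ (⊤ : ℕ∞) (dy f) :=
  (hf.fderiv_right (m := (⊤ : ℕ∞)) (by simp)).clm_apply contDiff_const

lemma dx_dy_comm {f : ℝ × ℝ → ℝ} (hf : ContDiff ℝ (⊤ : ℕ∞) f) (q : ℝ × ℝ) :
    dx (dy f) q = dy (dx f) q := by
  have hs : IsSymmSndFDerivAt ℝ f q :=
    hf.contDiffAt.isSymmSndFDerivAt (by
      simpa using WithTop.coe_le_coe.2 (le_top : (2 : ℕ∞) ≤ ⊤))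
  have hd : DifferentiableAt ℝ (fderiv ℝ f) q :=
    ((hf.fderiv_right (m := (⊤ : ℕ∞)) (by simp)).differentiable (by simp)) q
  have h1 : ∀ a b : ℝ × ℝ, fderiv ℝ (fun r => fderiv ℝ f r a) q b
      = fderiv ℝ (fderiv ℝ f) q b a := fun a b => by
    rw [fderiv_clm_apply hd (differentiableAt_const a)]
    simp
  unfold dx dy
  rw [h1, h1]
  exact hs _ _

lemma dx_affine {f : ℝ × ℝ → ℝ} (hf : ContDiff ℝ (⊤ : ℕ∞) f) (k x₀ a y₀ b x y : ℝ) :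
    dx (fun q => k * f (x₀ + a * q.1, y₀ + b * q.2)) (x, y)
      = k * a * dx f (x₀ + a * x, y₀ + b * y) := by
  refine dx_eq_of_hasDerivAt (by fun_prop) ?_
  have h := (hasDerivAt_dx hf (x₀ + a * x) (y₀ + b * y)).comp x
    (((hasDerivAt_id x).const_mul a).const_add x₀)
  have h2 := h.const_mul k
  exact h2.congr_deriv (by ring)

lemma dy_affine {f : ℝ × ℝ → ℝ} (hf : ContDiff ℝ (⊤ : ℕ∞) f) (k x₀ a y₀ b x y : ℝ) :
    dy (fun q => k * f (x₀ + a * q.1, y₀ + b * q.2)) (x, y)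
      = k * b * dy f (x₀ + a * x, y₀ + b * y) := by
  refine dy_eq_of_hasDerivAt (by fun_prop) ?_
  have h := (hasDerivAt_dy hf (x₀ + a * x) (y₀ + b * y)).comp y
    (((hasDerivAt_id y).const_mul b).const_add y₀)
  have h2 := h.const_mul k
  exact h2.congr_deriv (by ring)

end Calculus

section BoxIntegral

/-- The integral of `f` over the rectangle `[a, b] × [c, d]`. -/
def boxInt (a b c d : ℝ) (f : ℝ × ℝ → ℝ) : ℝ := ∫ q in Set.Icc a b ×ˢ Set.Icc c d, f q

variable {a b c d : ℝ} {f g : ℝ × ℝ → ℝ}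

lemma integrableOn_box (hf : Continuous f) : IntegrableOn f (Set.Icc a b ×ˢ Set.Icc c d) :=
  hf.continuousOn.integrableOn_compact (isCompact_Icc.prod isCompact_Icc)

lemma boxInt_mono (hf : Continuous f) (hg : Continuous g)
    (h : ∀ x ∈ Set.Icc a b, ∀ y ∈ Set.Icc c d, f (x, y) ≤ g (x, y)) :
    boxInt a b c d f ≤ boxInt a b c d g :=
  setIntegral_mono_on (integrableOn_box hf) (integrableOn_box hg)
    (measurableSet_Icc.prod measurableSet_Icc) fun q hq => h q.1 hq.1 q.2 hq.2

lemma boxInt_congr (h : ∀ x ∈ Set.Icc a b, ∀ y ∈ Set.Icc c d, f (x, y) = g (x, y)) :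
    boxInt a b c d f = boxInt a b c d g :=
  setIntegral_congr_fun (measurableSet_Icc.prod measurableSet_Icc)
    fun q hq => h q.1 hq.1 q.2 hq.2

lemma boxInt_nonneg (h : ∀ q, 0 ≤ f q) : 0 ≤ boxInt a b c d f :=
  integral_nonneg h

lemma boxInt_add (hf : Continuous f) (hg : Continuous g) :
    boxInt a b c d (fun q => f q + g q) = boxInt a b c d f + boxInt a b c d g :=
  integral_add (integrableOn_box hf) (integrableOn_box hg)

lemma boxInt_sub (hf : Continuous f) (hg : Continuous g) :
    boxInt a b c d (fun q => f q - g q) = boxInt a b c d f - boxInt a b c d g :=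
  integral_sub (integrableOn_box hf) (integrableOn_box hg)

lemma boxInt_const_mul (k : ℝ) :
    boxInt a b c d (fun q => k * f q) = k * boxInt a b c d f :=
  integral_const_mul _ _

lemma boxInt_const (hab : a ≤ b) (hcd : c ≤ d) (k : ℝ) :
    boxInt a b c d (fun _ => k) = (b - a) * (d - c) * k := by
  unfold boxInt
  rw [setIntegral_const, Measure.real, Measure.volume_eq_prod, Measure.prod_prod]
  simp [ENNReal.toReal_mul, hab, hcd]

lemma boxInt_eq (hab : a ≤ b) (hcd : c ≤ d) (hf : Continuous f) :
    boxInt a b c d f = ∫ x in a..b, ∫ y in c..d, f (x, y) := by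
  unfold boxInt
  rw [Measure.volume_eq_prod, setIntegral_prod _ (integrableOn_box hf),
    intervalIntegral.integral_of_le hab, integral_Icc_eq_integral_Ioc]
  simp_rw [intervalIntegral.integral_of_le hcd, integral_Icc_eq_integral_Ioc]

lemma boxInt_eq' (hab : a ≤ b) (hcd : c ≤ d) (hf : Continuous f) :
    boxInt a b c d f = ∫ y in c..d, ∫ x in a..b, f (x, y) := by
  have hi := integrableOn_box (a := a) (b := b) (c := c) (d := d) hf
  unfold boxInt
  rw [IntegrableOn, Measure.volume_eq_prod, ← Measure.prod_restrict] at hi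
  rw [Measure.volume_eq_prod, ← Measure.prod_restrict, integral_prod_symm _ hi,
    intervalIntegral.integral_of_le hcd, integral_Icc_eq_integral_Ioc]
  simp_rw [intervalIntegral.integral_of_le hab, integral_Icc_eq_integral_Ioc]

lemma boxInt_swap (hab : a ≤ b) (hcd : c ≤ d) (hf : Continuous f) :
    boxInt a b c d f = boxInt c d a b (fun q => f (q.2, q.1)) := by
  rw [boxInt_eq hab hcd hf, boxInt_eq' hcd hab (by fun_prop)]

lemma continuous_integral_right (hf : Continuous f) (c d : ℝ) :
    Continuous fun x => ∫ y in c..d, f (x, y) :=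
  intervalIntegral.continuous_parametric_intervalIntegral_of_continuous' (by fun_prop) _ _

lemma continuous_integral_left (hf : Continuous f) (a b : ℝ) :
    Continuous fun y => ∫ x in a..b, f (x, y) :=
  intervalIntegral.continuous_parametric_intervalIntegral_of_continuous'
    (f := fun y x => f (x, y)) (by fun_prop) _ _

lemma boxInt_split_left {m : ℝ} (ham : a ≤ m) (hmb : m ≤ b) (hcd : c ≤ d) (hf : Continuous f) :
    boxInt a b c d f = boxInt a m c d f + boxInt m b c d f := by
  rw [boxInt_eq (ham.trans hmb) hcd hf, boxInt_eq ham hcd hf, boxInt_eq hmb hcd hf,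
    intervalIntegral.integral_add_adjacent_intervals] <;>
  exact (continuous_integral_right hf c d).intervalIntegrable _ _

lemma boxInt_split_right {m : ℝ} (hcm : c ≤ m) (hmd : m ≤ d) (hab : a ≤ b) (hf : Continuous f) :
    boxInt a b c d f = boxInt a b c m f + boxInt a b m d f := by
  rw [boxInt_eq' hab (hcm.trans hmd) hf, boxInt_eq' hab hcm hf, boxInt_eq' hab hmd hf,
    intervalIntegral.integral_add_adjacent_intervals] <;>
  exact (continuous_integral_left hf a b).intervalIntegrable _ _

/-- Change of variables under an affine map scaling the coordinates independently. -/
lemma boxInt_comp_affine (hab : a ≤ b) (hcd : c ≤ d) (hf : Continuous f) {x₀ y₀ k l : ℝ}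
    (hk : 0 < k) (hl : 0 < l) :
    boxInt a b c d (fun q => f (x₀ + k * q.1, y₀ + l * q.2))
      = (k * l)⁻¹ * boxInt (x₀ + k * a) (x₀ + k * b) (y₀ + l * c) (y₀ + l * d) f := by
  rw [boxInt_eq hab hcd (by fun_prop),
    boxInt_eq (by nlinarith) (by nlinarith) hf]
  have h1 : ∀ x, ∫ y in c..d, f (x₀ + k * x, y₀ + l * y)
      = l⁻¹ * ∫ y in (y₀ + l * c)..(y₀ + l * d), f (x₀ + k * x, y) := fun x =>
    intervalIntegral.integral_comp_add_mul (fun y => f (x₀ + k * x, y)) hl.ne' y₀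
  simp only [h1, intervalIntegral.integral_const_mul]
  rw [intervalIntegral.integral_comp_add_mul
    (fun x => ∫ y in (y₀ + l * c)..(y₀ + l * d), f (x, y)) hk.ne' x₀, smul_eq_mul, mul_inv]
  ring

lemma boxInt_reflect_left (hab : a ≤ b) (hcd : c ≤ d) (hf : Continuous f) (m : ℝ) :
    boxInt a b c d (fun q => f (m - q.1, q.2)) = boxInt (m - b) (m - a) c d f := by
  rw [boxInt_eq hab hcd (by fun_prop), boxInt_eq (by linarith) hcd hf]
  exact intervalIntegral.integral_comp_sub_left (fun x => ∫ y in c..d, f (x, y)) m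

lemma boxInt_reflect_right (hab : a ≤ b) (hcd : c ≤ d) (hf : Continuous f) (m : ℝ) :
    boxInt a b c d (fun q => f (q.1, m - q.2)) = boxInt a b (m - d) (m - c) f := by
  rw [boxInt_eq' hab hcd (by fun_prop), boxInt_eq' hab (by linarith) hf]
  exact intervalIntegral.integral_comp_sub_left (fun y => ∫ x in a..b, f (x, y)) m

end BoxIntegral

section Reflection

/-- `f` vanishes at every point one of whose coordinates is at least `1`. -/
def VanishesBeyondOne (f : ℝ × ℝ → ℝ) : Prop := ∀ x y : ℝ, 1 ≤ x ∨ 1 ≤ y → f (x, y) = 0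

/-- The combination `c f(x, y) + e f(2 * x, y)` used in Nitsche's reflection across `x = 0`. -/
def combX (c e : ℝ) (f : ℝ × ℝ → ℝ) (q : ℝ × ℝ) : ℝ := c * f q + e * f (2 * q.1, q.2)

/-- The combination `c f(x, y) + e f(x, 2 * y)` used in Nitsche's reflection across `y = 0`. -/
def combY (c e : ℝ) (f : ℝ × ℝ → ℝ) (q : ℝ × ℝ) : ℝ := c * f q + e * f (q.1, 2 * q.2)

variable {f u v : ℝ × ℝ → ℝ}

lemma VanishesBeyondOne.dx (h : VanishesBeyondOne f) (hf : ContDiff ℝ (⊤ : ℕ∞) f) :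
    VanishesBeyondOne (dx f) := fun x y hxy => by
  have h1 := (hasDerivAt_dx hf x y).hasDerivWithinAt (s := Set.Ici x)
  have h2 : HasDerivWithinAt (fun t => f (t, y)) 0 (Set.Ici x) x :=
    (hasDerivWithinAt_const x (Set.Ici x) (0 : ℝ)).congr
      (fun t ht => h t y (hxy.imp_left fun hx => hx.trans ht)) (h x y hxy)
  exact (uniqueDiffOn_Ici x x Set.self_mem_Ici).eq_deriv _ h1 h2

lemma VanishesBeyondOne.dy (h : VanishesBeyondOne f) (hf : ContDiff ℝ (⊤ : ℕ∞) f) :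
    VanishesBeyondOne (dy f) := fun x y hxy => by
  have h1 := (hasDerivAt_dy hf x y).hasDerivWithinAt (s := Set.Ici y)
  have h2 : HasDerivWithinAt (fun t => f (x, t)) 0 (Set.Ici y) y :=
    (hasDerivWithinAt_const y (Set.Ici y) (0 : ℝ)).congr
      (fun t ht => h x t (hxy.imp_right fun hy => hy.trans ht)) (h x y hxy)
  exact (uniqueDiffOn_Ici y y Set.self_mem_Ici).eq_deriv _ h1 h2

lemma VanishesBeyondOne.combX (h : VanishesBeyondOne f) (c e : ℝ) :
    VanishesBeyondOne (combX c e f) := fun x y hxy => by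
  have : f (2 * x, y) = 0 := h _ _ (hxy.imp_left fun hx => by linarith)
  simp [_root_.combX, h x y hxy, this]

lemma VanishesBeyondOne.combY (h : VanishesBeyondOne f) (c e : ℝ) :
    VanishesBeyondOne (combY c e f) := fun x y hxy => by
  have : f (x, 2 * y) = 0 := h _ _ (hxy.imp_right fun hx => by linarith)
  simp [_root_.combY, h x y hxy, this]

lemma VanishesBeyondOne.add {g : ℝ × ℝ → ℝ} (h : VanishesBeyondOne f)
    (hg : VanishesBeyondOne g) : VanishesBeyondOne (fun q => f q + g q) := fun x y hxy => by
  simp [h x y hxy, hg x y hxy]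

lemma contDiff_combX (hf : ContDiff ℝ (⊤ : ℕ∞) f) (c e : ℝ) :
    ContDiff ℝ (⊤ : ℕ∞) (combX c e f) := by
  unfold combX; fun_prop

lemma contDiff_combY (hf : ContDiff ℝ (⊤ : ℕ∞) f) (c e : ℝ) :
    ContDiff ℝ (⊤ : ℕ∞) (combY c e f) := by
  unfold combY; fun_prop

lemma continuous_combX (hf : Continuous f) (c e : ℝ) : Continuous (combX c e f) := by
  unfold combX; fun_prop

lemma continuous_combY (hf : Continuous f) (c e : ℝ) : Continuous (combY c e f) := by
  unfold combY; fun_prop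

lemma dx_combX (hf : ContDiff ℝ (⊤ : ℕ∞) f) (c e : ℝ) :
    dx (combX c e f) = combX c (2 * e) (dx f) := by
  ext ⟨x, y⟩
  refine dx_eq_of_hasDerivAt (contDiff_combX hf c e) ?_
  have h2 := ((hasDerivAt_dx hf (2 * x) y).comp x ((hasDerivAt_id x).const_mul 2)).const_mul e
  exact (((hasDerivAt_dx hf x y).const_mul c).add h2).congr_deriv (by simp only [combX]; ring)

lemma dy_combX (hf : ContDiff ℝ (⊤ : ℕ∞) f) (c e : ℝ) :
    dy (combX c e f) = combX c e (dy f) := by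
  ext ⟨x, y⟩
  refine dy_eq_of_hasDerivAt (contDiff_combX hf c e) ?_
  exact ((hasDerivAt_dy hf x y).const_mul c).add ((hasDerivAt_dy hf (2 * x) y).const_mul e)

lemma dy_combY (hf : ContDiff ℝ (⊤ : ℕ∞) f) (c e : ℝ) :
    dy (combY c e f) = combY c (2 * e) (dy f) := by
  ext ⟨x, y⟩
  refine dy_eq_of_hasDerivAt (contDiff_combY hf c e) ?_
  have h2 := ((hasDerivAt_dy hf x (2 * y)).comp y ((hasDerivAt_id y).const_mul 2)).const_mul e
  exact (((hasDerivAt_dy hf x y).const_mul c).add h2).congr_deriv (by simp only [combY]; ring)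

lemma dx_combY (hf : ContDiff ℝ (⊤ : ℕ∞) f) (c e : ℝ) :
    dx (combY c e f) = combY c e (dx f) := by
  ext ⟨x, y⟩
  refine dx_eq_of_hasDerivAt (contDiff_combY hf c e) ?_
  exact ((hasDerivAt_dx hf x y).const_mul c).add ((hasDerivAt_dx hf x (2 * y)).const_mul e)

lemma combX_combY_comm (c e c' e' : ℝ) (f : ℝ × ℝ → ℝ) :
    combX c e (combY c' e' f) = combY c' e' (combX c e f) := by
  ext q; simp only [combX, combY]; ring

lemma boxInt_sq_combX_le (hf : Continuous f) (h : VanishesBeyondOne f) (c e : ℝ) :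
    boxInt 0 1 0 1 (fun q => combX c e f q ^ 2)
      ≤ 2 * (c ^ 2 + e ^ 2) * boxInt 0 1 0 1 (fun q => f q ^ 2) := by
  have hs : boxInt 0 1 0 1 (fun q => f (2 * q.1, q.2) ^ 2)
      ≤ boxInt 0 1 0 1 (fun q => f q ^ 2) := by
    have h1 := boxInt_comp_affine (a := 0) (b := 1) (c := 0) (d := 1) (f := fun q => f q ^ 2)
      (x₀ := 0) (y₀ := 0) (k := 2) (l := 1) zero_le_one zero_le_one (by fun_prop)
      two_pos one_pos
    have h2 := boxInt_split_left (a := 0) (m := 1) (b := 2) (c := 0) (d := 1)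
      (f := fun q => f q ^ 2) (by norm_num) (by norm_num) (by norm_num) (by fun_prop)
    have h3 : boxInt 1 2 0 1 (fun q => f q ^ 2) = 0 := by
      rw [boxInt_congr (g := fun _ => 0) fun x hx y _ => by simp [h x y (Or.inl hx.1)]]
      simp [boxInt]
    have h4 : 0 ≤ boxInt 0 1 0 1 (fun q => f q ^ 2) := boxInt_nonneg fun q => sq_nonneg _
    simp only [zero_add, one_mul, mul_one, mul_zero] at h1
    rw [h1, h2, h3]
    linarith
  calc boxInt 0 1 0 1 (fun q => combX c e f q ^ 2)
      ≤ boxInt 0 1 0 1 (fun q => 2 * c ^ 2 * f q ^ 2 + 2 * e ^ 2 * f (2 * q.1, q.2) ^ 2) := by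
        have := continuous_combX hf c e
        refine boxInt_mono (by fun_prop) (by fun_prop) fun x _ y _ => ?_
        simp only [combX]
        nlinarith [sq_nonneg (c * f (x, y) - e * f (2 * x, y))]
    _ ≤ _ := by
        rw [boxInt_add (by fun_prop) (by fun_prop), boxInt_const_mul, boxInt_const_mul]
        nlinarith [sq_nonneg e]

lemma boxInt_sq_combY_le (hf : Continuous f) (h : VanishesBeyondOne f) (c e : ℝ) :
    boxInt 0 1 0 1 (fun q => combY c e f q ^ 2)
      ≤ 2 * (c ^ 2 + e ^ 2) * boxInt 0 1 0 1 (fun q => f q ^ 2) := by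
  have hc := continuous_combY hf c e
  rw [boxInt_swap zero_le_one zero_le_one (by fun_prop),
    boxInt_swap (f := fun q => f q ^ 2) zero_le_one zero_le_one (by fun_prop)]
  exact boxInt_sq_combX_le (f := fun q => f (q.2, q.1)) (by fun_prop)
    (fun x y hxy => h y x hxy.symm) c e

/-- The Jacobian-type form `u_y v_x - u_x v_y`. -/
def mixedForm (u v : ℝ × ℝ → ℝ) (q : ℝ × ℝ) : ℝ := dy u q * dx v q - dx u q * dy v q

lemma continuous_mixedForm (hu : ContDiff ℝ (⊤ : ℕ∞) u) (hv : ContDiff ℝ (⊤ : ℕ∞) v) :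
    Continuous (mixedForm u v) := by
  have := (contDiff_dx hu).continuous
  have := (contDiff_dy hu).continuous
  have := (contDiff_dx hv).continuous
  have := (contDiff_dy hv).continuous
  unfold mixedForm; fun_prop

lemma boxInt_mixedForm (hu : ContDiff ℝ (⊤ : ℕ∞) u) (hv : ContDiff ℝ (⊤ : ℕ∞) v)
    (h : VanishesBeyondOne u) :
    boxInt 0 1 0 1 (mixedForm u v)
      = (∫ y in (0 : ℝ)..1, u (0, y) * dy v (0, y))
        - ∫ x in (0 : ℝ)..1, u (x, 0) * dx v (x, 0) := by
  have hvx := contDiff_dx hv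
  have hvy := contDiff_dy hv
  have hfd : ∀ q, HasFDerivAt (fun q => -(u q * dy v q))
      (-(u q • fderiv ℝ (dy v) q + dy v q • fderiv ℝ u q)) q := fun q =>
    ((hu.differentiable (by simp) q).hasFDerivAt.mul
      (hvy.differentiable (by simp) q).hasFDerivAt).neg
  have hgd : ∀ q, HasFDerivAt (fun q => u q * dx v q)
      (u q • fderiv ℝ (dx v) q + dx v q • fderiv ℝ u q) q := fun q =>
    (hu.differentiable (by simp) q).hasFDerivAt.mul
      (hvx.differentiable (by simp) q).hasFDerivAt
  have heq : ∀ q : ℝ × ℝ, (-(u q • fderiv ℝ (dy v) q + dy v q • fderiv ℝ u q)) (1, 0)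
      + (u q • fderiv ℝ (dx v) q + dx v q • fderiv ℝ u q) (0, 1) = mixedForm u v q := fun q => by
    have hsymm : fderiv ℝ (dy v) q (1, 0) = fderiv ℝ (dx v) q (0, 1) := dx_dy_comm hv q
    simp only [neg_apply, add_apply, smul_apply, smul_eq_mul, hsymm, mixedForm, dx, dy]
    ring
  have hD := integral_divergence_prod_Icc_of_hasFDerivAt_of_le (fun q => -(u q * dy v q))
    (fun q => u q * dx v q) _ _ ((0 : ℝ), (0 : ℝ)) ((1 : ℝ), (1 : ℝ)) (by simp [Prod.le_def])
    (hu.continuous.mul hvy.continuous).neg.continuousOn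
    (hu.continuous.mul hvx.continuous).continuousOn (fun q _ => hfd q) (fun q _ => hgd q)
    (by simp_rw [heq]; exact (continuous_mixedForm hu hv).integrableOn_Icc)
  simp_rw [heq] at hD
  rw [← Set.Icc_prod_Icc] at hD
  rw [boxInt, hD]
  simp [h _ 1 (Or.inr le_rfl), h 1 _ (Or.inl le_rfl)]
  ring

lemma boxInt_sq_dy_le (hu : ContDiff ℝ (⊤ : ℕ∞) u) (hv : ContDiff ℝ (⊤ : ℕ∞) v) :
    boxInt 0 1 0 1 (fun q => dy u q ^ 2) ≤ -2 * boxInt 0 1 0 1 (mixedForm u v)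
      + (boxInt 0 1 0 1 (fun q => (dy u q + dx v q) ^ 2)
        + boxInt 0 1 0 1 (fun q => dx u q ^ 2) + boxInt 0 1 0 1 (fun q => dy v q ^ 2)) := by
  have := (contDiff_dx hu).continuous
  have := (contDiff_dy hu).continuous
  have := (contDiff_dx hv).continuous
  have := (contDiff_dy hv).continuous
  have hm := continuous_mixedForm hu hv
  rw [← boxInt_const_mul, ← boxInt_add (by fun_prop) (by fun_prop),
    ← boxInt_add (by fun_prop) (by fun_prop), ← boxInt_add (by fun_prop) (by fun_prop)]
  refine boxInt_mono (by fun_prop) (by fun_prop) fun x _ y _ => ?_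
  simp only [mixedForm]
  nlinarith [sq_nonneg (dx v (x, y)), sq_nonneg (dx u (x, y) + dy v (x, y))]

lemma neg_boxInt_mixedForm_le (hu : ContDiff ℝ (⊤ : ℕ∞) u) (hv : ContDiff ℝ (⊤ : ℕ∞) v) :
    -2 * boxInt 0 1 0 1 (mixedForm u v)
      ≤ boxInt 0 1 0 1 (fun q => (dy u q - dx v q) ^ 2)
        + boxInt 0 1 0 1 (fun q => dx u q ^ 2) + boxInt 0 1 0 1 (fun q => dy v q ^ 2) := by
  have := (contDiff_dx hu).continuous
  have := (contDiff_dy hu).continuous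
  have := (contDiff_dx hv).continuous
  have := (contDiff_dy hv).continuous
  have hm := continuous_mixedForm hu hv
  rw [← boxInt_const_mul, ← boxInt_add (by fun_prop) (by fun_prop),
    ← boxInt_add (by fun_prop) (by fun_prop)]
  refine boxInt_mono (by fun_prop) (by fun_prop) fun x _ y _ => ?_
  simp only [mixedForm]
  nlinarith [sq_nonneg (dx v (x, y)), sq_nonneg (dy u (x, y)), sq_nonneg (dx u (x, y) - dy v (x, y))]

/-- Reflecting across `y = 0` does not change the boundary term on that side. -/
lemma combY_mul_dx_combY (hv : ContDiff ℝ (⊤ : ℕ∞) v) (x : ℝ) :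
    combY 3 (-2) u (x, 0) * dx (combY (-3) 4 v) (x, 0) = u (x, 0) * dx v (x, 0) := by
  rw [dx_combY hv]; simp only [combY, mul_zero]; ring

lemma combX_mul_dy_combX (hv : ContDiff ℝ (⊤ : ℕ∞) v) (y : ℝ) :
    combX (-3) 4 u (0, y) * dy (combX 3 (-2) v) (0, y) = u (0, y) * dy v (0, y) := by
  rw [dy_combX hv]; simp only [combX, mul_zero]; ring

/-- Korn's first inequality in a corner, without boundary conditions on the two adjacent sides. -/
lemma korn_corner (hu : ContDiff ℝ (⊤ : ℕ∞) u) (hv : ContDiff ℝ (⊤ : ℕ∞) v)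
    (hu0 : VanishesBeyondOne u) (hv0 : VanishesBeyondOne v) :
    boxInt 0 1 0 1 (fun q => dy u q ^ 2) ≤ 4000 *
      (boxInt 0 1 0 1 (fun q => dx u q ^ 2) + boxInt 0 1 0 1 (fun q => (dy u q + dx v q) ^ 2)
        + boxInt 0 1 0 1 (fun q => dy v q ^ 2)) := by
  have hux := (contDiff_dx hu).continuous
  have huy := (contDiff_dy hu).continuous
  have hvx := (contDiff_dx hv).continuous
  have hvy := (contDiff_dy hv).continuous
  have hux0 := hu0.dx hu
  have hvy0 := hv0.dy hv
  set s : ℝ × ℝ → ℝ := fun q => dy u q + dx v q with hs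
  have hsc : Continuous s := by fun_prop
  have hs0 : VanishesBeyondOne s := (hu0.dy hu).add (hv0.dx hv)
  have hu1 := contDiff_combY hu 3 (-2)
  have hv1 := contDiff_combY hv (-3) 4
  have hu2 := contDiff_combX hu (-3) 4
  have hv2 := contDiff_combX hv 3 (-2)
  have hu3 := contDiff_combX hu1 (-3) 4
  have hv3 := contDiff_combX hv1 3 (-2)
  have hu1' := hu0.combY 3 (-2)
  have hu2' := hu0.combX (-3) 4
  have hu3' := hu1'.combX (-3) 4
  have hsum : boxInt 0 1 0 1 (mixedForm u v)
      + boxInt 0 1 0 1 (mixedForm (combX (-3) 4 (combY 3 (-2) u)) (combX 3 (-2) (combY (-3) 4 v)))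
      = boxInt 0 1 0 1 (mixedForm (combY 3 (-2) u) (combY (-3) 4 v))
      + boxInt 0 1 0 1 (mixedForm (combX (-3) 4 u) (combX 3 (-2) v)) := by
    rw [boxInt_mixedForm hu hv hu0, boxInt_mixedForm hu1 hv1 hu1', boxInt_mixedForm hu2 hv2 hu2',
      boxInt_mixedForm hu3 hv3 hu3']
    simp only [combX_mul_dy_combX hv, combX_mul_dy_combX hv1]
    simp only [combX_combY_comm, combY_mul_dx_combY hv, combY_mul_dx_combY hv2]
    ring
  have i0 := boxInt_sq_dy_le hu hv
  have i1 := neg_boxInt_mixedForm_le hu1 hv1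
  have i2 := neg_boxInt_mixedForm_le hu2 hv2
  have i3 := boxInt_sq_dy_le hu3 hv3
  have i3' : 0 ≤ boxInt 0 1 0 1 (fun q => dy (combX (-3) 4 (combY 3 (-2) u)) q ^ 2) :=
    boxInt_nonneg fun q => sq_nonneg _
  have e1 : (fun q => (dy (combY 3 (-2) u) q - dx (combY (-3) 4 v) q) ^ 2)
      = fun q => combY 3 (-4) s q ^ 2 := by
    ext q; rw [dy_combY hu, dx_combY hv]; simp only [combY, hs]; ring
  have e2 : (fun q => (dy (combX (-3) 4 u) q - dx (combX 3 (-2) v) q) ^ 2)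
      = fun q => combX (-3) 4 s q ^ 2 := by
    ext q; rw [dy_combX hu, dx_combX hv]; simp only [combX, hs]; ring
  have e3 : (fun q => (dy (combX (-3) 4 (combY 3 (-2) u)) q
        + dx (combX 3 (-2) (combY (-3) 4 v)) q) ^ 2)
      = fun q => combX (-3) 4 (combY 3 (-4) s) q ^ 2 := by
    ext q; rw [dy_combX hu1, dx_combX hv1, dy_combY hu, dx_combY hv]
    simp only [combX, combY, hs]; ring
  rw [e1, dx_combY hu, dy_combY hv] at i1
  rw [e2, dx_combX hu, dy_combX hv] at i2
  rw [e3, dx_combX hu1, dy_combX hv1, dx_combY hu, dy_combY hv] at i3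
  have b1 := boxInt_sq_combY_le hsc hs0 3 (-4)
  have b2 := boxInt_sq_combX_le hsc hs0 (-3) 4
  have b3 := boxInt_sq_combX_le (continuous_combY hsc 3 (-4)) (hs0.combY 3 (-4)) (-3) 4
  have b4 := boxInt_sq_combY_le hux hux0 3 (-2)
  have b5 := boxInt_sq_combX_le hux hux0 (-3) (2 * 4)
  have b6 := boxInt_sq_combX_le (continuous_combY hux 3 (-2)) (hux0.combY 3 (-2)) (-3) (2 * 4)
  have b7 := boxInt_sq_combY_le hvy hvy0 (-3) (2 * 4)
  have b8 := boxInt_sq_combX_le hvy hvy0 3 (-2)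
  have b9 := boxInt_sq_combX_le (continuous_combY hvy (-3) (2 * 4)) (hvy0.combY (-3) (2 * 4)) 3 (-2)
  have p1 : 0 ≤ boxInt 0 1 0 1 (fun q => s q ^ 2) := boxInt_nonneg fun q => sq_nonneg _
  have p2 : 0 ≤ boxInt 0 1 0 1 (fun q => dx u q ^ 2) := boxInt_nonneg fun q => sq_nonneg _
  have p3 : 0 ≤ boxInt 0 1 0 1 (fun q => dy v q ^ 2) := boxInt_nonneg fun q => sq_nonneg _
  linarith

end Reflection

section Cutoff

/-- A multiple of the squared norm of the symmetrized gradient of `(u, v)`. -/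
def strainSq (u v : ℝ × ℝ → ℝ) (q : ℝ × ℝ) : ℝ :=
  dx u q ^ 2 + (dy u q + dx v q) ^ 2 + dy v q ^ 2

lemma strainSq_nonneg (u v : ℝ × ℝ → ℝ) (q : ℝ × ℝ) : 0 ≤ strainSq u v q := by
  unfold strainSq; positivity

variable {u v : ℝ × ℝ → ℝ}

lemma continuous_strainSq (hu : ContDiff ℝ (⊤ : ℕ∞) u) (hv : ContDiff ℝ (⊤ : ℕ∞) v) :
    Continuous (strainSq u v) := by
  have := (contDiff_dx hu).continuous
  have := (contDiff_dy hu).continuous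
  have := (contDiff_dx hv).continuous
  have := (contDiff_dy hv).continuous
  unfold strainSq; fun_prop

/-- A smooth function on the line equal to `1` on `t ≤ 1/2` and to `0` on `t ≥ 1`. -/
def cutoff (t : ℝ) : ℝ := Real.smoothTransition (2 - 2 * t)

lemma contDiff_cutoff : ContDiff ℝ (⊤ : ℕ∞) cutoff :=
  Real.smoothTransition.contDiff.comp (by fun_prop)

lemma cutoff_sq_le_one (t : ℝ) : cutoff t ^ 2 ≤ 1 := by
  have h0 := Real.smoothTransition.nonneg (2 - 2 * t)
  have h1 := Real.smoothTransition.le_one (2 - 2 * t)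
  exact pow_le_one₀ h0 h1

lemma cutoff_eq_one {t : ℝ} (ht : t ≤ 1 / 2) : cutoff t = 1 :=
  Real.smoothTransition.one_of_one_le (by linarith)

lemma cutoff_eq_zero {t : ℝ} (ht : 1 ≤ t) : cutoff t = 0 :=
  Real.smoothTransition.zero_of_nonpos (by linarith)

lemma exists_deriv_cutoff_sq_le : ∃ M : ℝ, 0 ≤ M ∧ ∀ t ∈ Set.Icc (0 : ℝ) 1,
    deriv cutoff t ^ 2 ≤ M := by
  have hc : Continuous (fun t => deriv cutoff t ^ 2) :=
    (contDiff_cutoff.continuous_deriv (by simp)).pow 2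
  obtain ⟨M, hM⟩ := (isCompact_Icc (a := (0 : ℝ)) (b := 1)).bddAbove_image hc.continuousOn
  have h : ∀ t ∈ Set.Icc (0 : ℝ) 1, deriv cutoff t ^ 2 ≤ M := fun t ht =>
    hM (Set.mem_image_of_mem _ ht)
  exact ⟨M, (sq_nonneg _).trans (h 0 (by simp)), h⟩

/-- The localization of `f` near the corner `(0, 0)`. -/
def localize (f : ℝ × ℝ → ℝ) (q : ℝ × ℝ) : ℝ := cutoff q.1 * cutoff q.2 * f q

variable {f : ℝ × ℝ → ℝ}

lemma contDiff_localize (hf : ContDiff ℝ (⊤ : ℕ∞) f) : ContDiff ℝ (⊤ : ℕ∞) (localize f) := by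
  have := contDiff_cutoff
  unfold localize; fun_prop

lemma vanishesBeyondOne_localize (f : ℝ × ℝ → ℝ) : VanishesBeyondOne (localize f) := by
  rintro x y (h | h) <;> simp [localize, cutoff_eq_zero h]

lemma hasDerivAt_cutoff (t : ℝ) : HasDerivAt cutoff (deriv cutoff t) t :=
  (contDiff_cutoff.differentiable (by simp) t).hasDerivAt

lemma dx_localize (hf : ContDiff ℝ (⊤ : ℕ∞) f) (x y : ℝ) :
    dx (localize f) (x, y)
      = cutoff x * cutoff y * dx f (x, y) + deriv cutoff x * cutoff y * f (x, y) := by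
  refine dx_eq_of_hasDerivAt (contDiff_localize hf) ?_
  exact (((hasDerivAt_cutoff x).mul_const (cutoff y)).mul (hasDerivAt_dx hf x y)).congr_deriv
    (by ring)

lemma dy_localize (hf : ContDiff ℝ (⊤ : ℕ∞) f) (x y : ℝ) :
    dy (localize f) (x, y)
      = cutoff x * cutoff y * dy f (x, y) + cutoff x * deriv cutoff y * f (x, y) := by
  refine dy_eq_of_hasDerivAt (contDiff_localize hf) ?_
  exact (((hasDerivAt_cutoff y).const_mul (cutoff x)).mul (hasDerivAt_dy hf x y)).congr_deriv
    (by ring)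

lemma sq_linear_combination_le {p r t a b c M : ℝ} (hp : p ^ 2 ≤ 1) (hr : r ^ 2 ≤ M)
    (ht : t ^ 2 ≤ M) :
    (p * a + r * b + t * c) ^ 2 ≤ 3 * a ^ 2 + 3 * M * (b ^ 2 + c ^ 2) := by
  have h1 : (p * a + r * b + t * c) ^ 2 ≤ 3 * (p ^ 2 * a ^ 2 + r ^ 2 * b ^ 2 + t ^ 2 * c ^ 2) := by
    nlinarith [sq_nonneg (p * a - r * b), sq_nonneg (p * a - t * c), sq_nonneg (r * b - t * c)]
  have h2 := mul_le_mul_of_nonneg_right hp (sq_nonneg a)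
  have h3 := mul_le_mul_of_nonneg_right hr (sq_nonneg b)
  have h4 := mul_le_mul_of_nonneg_right ht (sq_nonneg c)
  linarith

lemma korn_quarter : ∃ K : ℝ, 0 ≤ K ∧ ∀ u v : ℝ × ℝ → ℝ,
    ContDiff ℝ (⊤ : ℕ∞) u → ContDiff ℝ (⊤ : ℕ∞) v →
    boxInt 0 (1 / 2) 0 (1 / 2) (fun q => dy u q ^ 2)
      ≤ K * boxInt 0 1 0 1 (fun q => strainSq u v q + (u q ^ 2 + v q ^ 2)) := by
  obtain ⟨M, hM0, hM⟩ := exists_deriv_cutoff_sq_le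
  refine ⟨4000 * (3 + 9 * M), by positivity, fun u v hu hv => ?_⟩
  have hU := contDiff_localize hu
  have hV := contDiff_localize hv
  have hUx := (contDiff_dx hU).continuous
  have hUy := (contDiff_dy hU).continuous
  have hVx := (contDiff_dx hV).continuous
  have hVy := (contDiff_dy hV).continuous
  have huy := (contDiff_dy hu).continuous
  have hE := continuous_strainSq hu hv
  have hE' := continuous_strainSq hU hV
  have huc := hu.continuous
  have hvc := hv.continuous
  have h1 : boxInt 0 (1 / 2) 0 (1 / 2) (fun q => dy u q ^ 2)
      ≤ boxInt 0 (1 / 2) 0 (1 / 2) (fun q => dy (localize u) q ^ 2) := by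
    refine boxInt_mono (by fun_prop) (by fun_prop) fun x hx y hy => ?_
    have hy' : dy (localize u) (x, y) = dy u (x, y) + deriv cutoff y * u (x, y) := by
      rw [dy_localize hu, cutoff_eq_one hx.2, cutoff_eq_one hy.2]; ring
    have hz : deriv cutoff y = 0 := by
      have h1 := (hasDerivAt_cutoff y).hasDerivWithinAt (s := Set.Iic y)
      have h2 : HasDerivWithinAt cutoff 0 (Set.Iic y) y :=
        (hasDerivWithinAt_const y (Set.Iic y) (1 : ℝ)).congr
          (fun t ht => cutoff_eq_one (le_trans ht hy.2)) (cutoff_eq_one hy.2)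
      exact (uniqueDiffOn_Iic y y Set.self_mem_Iic).eq_deriv _ h1 h2
    rw [hy', hz]; simp
  have h2 : boxInt 0 (1 / 2) 0 (1 / 2) (fun q => dy (localize u) q ^ 2)
      ≤ boxInt 0 1 0 1 (fun q => dy (localize u) q ^ 2) := by
    have hs1 := boxInt_split_left (a := 0) (m := 1 / 2) (b := 1) (c := 0) (d := 1)
      (f := fun q => dy (localize u) q ^ 2) (by norm_num) (by norm_num) (by norm_num) (by fun_prop)
    have hs2 := boxInt_split_right (a := 0) (b := 1 / 2) (m := 1 / 2) (c := 0) (d := 1)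
      (f := fun q => dy (localize u) q ^ 2) (by norm_num) (by norm_num) (by norm_num) (by fun_prop)
    have hn1 : 0 ≤ boxInt (1 / 2) 1 0 1 (fun q => dy (localize u) q ^ 2) :=
      boxInt_nonneg fun q => sq_nonneg _
    have hn2 : 0 ≤ boxInt 0 (1 / 2) (1 / 2) 1 (fun q => dy (localize u) q ^ 2) :=
      boxInt_nonneg fun q => sq_nonneg _
    linarith
  have h3 := korn_corner hU hV (vanishesBeyondOne_localize u) (vanishesBeyondOne_localize v)
  rw [← boxInt_add (by fun_prop) (by fun_prop), ← boxInt_add (by fun_prop) (by fun_prop)] at h3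
  have h4 : boxInt 0 1 0 1 (strainSq (localize u) (localize v))
      ≤ (3 + 9 * M) * boxInt 0 1 0 1 (fun q => strainSq u v q + (u q ^ 2 + v q ^ 2)) := by
    rw [← boxInt_const_mul]
    refine boxInt_mono hE' (by fun_prop) fun x hx y hy => ?_
    have hcx := cutoff_sq_le_one x
    have hcy := cutoff_sq_le_one y
    have hp : (cutoff x * cutoff y) ^ 2 ≤ 1 := by
      rw [mul_pow]; exact mul_le_one₀ hcx (sq_nonneg _) hcy
    have hr : (deriv cutoff x * cutoff y) ^ 2 ≤ M := by
      rw [mul_pow]; exact (mul_le_of_le_one_right (sq_nonneg _) hcy).trans (hM x hx)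
    have ht : (cutoff x * deriv cutoff y) ^ 2 ≤ M := by
      rw [mul_pow]; exact (mul_le_of_le_one_left (sq_nonneg _) hcx).trans (hM y hy)
    have b1 := sq_linear_combination_le (a := dx u (x, y)) (b := u (x, y)) (c := 0) hp hr ht
    have b2 := sq_linear_combination_le (a := dy u (x, y) + dx v (x, y)) (b := v (x, y))
      (c := u (x, y)) hp hr ht
    have b3 := sq_linear_combination_le (a := dy v (x, y)) (b := 0) (c := v (x, y)) hp hr ht
    have hE0 := strainSq_nonneg u v (x, y)
    have e : strainSq (localize u) (localize v) (x, y)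
        = (cutoff x * cutoff y * dx u (x, y) + deriv cutoff x * cutoff y * u (x, y)
            + cutoff x * deriv cutoff y * 0) ^ 2
          + (cutoff x * cutoff y * (dy u (x, y) + dx v (x, y))
            + deriv cutoff x * cutoff y * v (x, y) + cutoff x * deriv cutoff y * u (x, y)) ^ 2
          + (cutoff x * cutoff y * dy v (x, y) + deriv cutoff x * cutoff y * 0
            + cutoff x * deriv cutoff y * v (x, y)) ^ 2 := by
      unfold strainSq
      rw [dx_localize hu, dy_localize hu, dx_localize hv, dy_localize hv]; ring
    rw [e]
    have q1 := mul_nonneg hM0 hE0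
    have q2 := mul_nonneg hM0 (sq_nonneg (u (x, y)))
    have q3 := mul_nonneg hM0 (sq_nonneg (v (x, y)))
    have q4 := sq_nonneg (u (x, y))
    have q5 := sq_nonneg (v (x, y))
    unfold strainSq at hE0 q1 ⊢
    linarith
  calc _ ≤ _ := h1.trans (h2.trans h3)
    _ ≤ 4000 * ((3 + 9 * M)
        * boxInt 0 1 0 1 (fun q => strainSq u v q + (u q ^ 2 + v q ^ 2))) := by
      exact mul_le_mul_of_nonneg_left h4 (by norm_num)
    _ = _ := by ring

lemma korn_half : ∃ K : ℝ, 0 ≤ K ∧ ∀ u v : ℝ × ℝ → ℝ,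
    ContDiff ℝ (⊤ : ℕ∞) u → ContDiff ℝ (⊤ : ℕ∞) v →
    boxInt 0 1 0 (1 / 2) (fun q => dy u q ^ 2)
      ≤ K * boxInt 0 1 0 1 (fun q => strainSq u v q + (u q ^ 2 + v q ^ 2)) := by
  obtain ⟨K, hK0, hK⟩ := korn_quarter
  refine ⟨2 * K, by positivity, fun u v hu hv => ?_⟩
  have huy := (contDiff_dy hu).continuous
  have hE := continuous_strainSq hu hv
  have huc := hu.continuous
  have hvc := hv.continuous
  have h1 := hK u v hu hv
  have h2 := hK (fun q => -1 * u (1 + -1 * q.1, 0 + 1 * q.2))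
    (fun q => 1 * v (1 + -1 * q.1, 0 + 1 * q.2)) (by fun_prop) (by fun_prop)
  have r1 := boxInt_reflect_left (a := 0) (b := 1 / 2) (c := 0) (d := 1 / 2)
    (f := fun q => dy u q ^ 2) (by norm_num) (by norm_num) (by fun_prop) 1
  have r2 := boxInt_reflect_left (a := 0) (b := 1) (c := 0) (d := 1)
    (f := fun q => strainSq u v q + (u q ^ 2 + v q ^ 2)) (by norm_num) (by norm_num)
    (by fun_prop) 1
  have hs := boxInt_split_left (a := 0) (m := 1 / 2) (b := 1) (c := 0) (d := 1 / 2)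
    (f := fun q => dy u q ^ 2) (by norm_num) (by norm_num) (by norm_num) (by fun_prop)
  have c1 : boxInt 0 (1 / 2) 0 (1 / 2)
      (fun q => dy (fun q => -1 * u (1 + -1 * q.1, 0 + 1 * q.2)) q ^ 2)
      = boxInt 0 (1 / 2) 0 (1 / 2) (fun q => dy u (1 - q.1, q.2) ^ 2) :=
    boxInt_congr fun x _ y _ => by rw [dy_affine hu]; ring_nf
  have c2 : boxInt 0 1 0 1 (fun q => strainSq (fun q => -1 * u (1 + -1 * q.1, 0 + 1 * q.2))
        (fun q => 1 * v (1 + -1 * q.1, 0 + 1 * q.2)) q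
        + ((-1 * u (1 + -1 * q.1, 0 + 1 * q.2)) ^ 2 + (1 * v (1 + -1 * q.1, 0 + 1 * q.2)) ^ 2))
      = boxInt 0 1 0 1 (fun q => strainSq u v (1 - q.1, q.2)
        + (u (1 - q.1, q.2) ^ 2 + v (1 - q.1, q.2) ^ 2)) :=
    boxInt_congr fun x _ y _ => by
      unfold strainSq
      rw [dx_affine hu, dy_affine hu, dx_affine hv, dy_affine hv]; ring_nf
  rw [c1, c2, r1, r2] at h2
  norm_num at h2 hs h1 ⊢
  linarith

lemma korn_square_with_lower_order : ∃ K : ℝ, 0 ≤ K ∧ ∀ u v : ℝ × ℝ → ℝ,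
    ContDiff ℝ (⊤ : ℕ∞) u → ContDiff ℝ (⊤ : ℕ∞) v →
    boxInt 0 1 0 1 (fun q => dy u q ^ 2)
      ≤ K * boxInt 0 1 0 1 (fun q => strainSq u v q + (u q ^ 2 + v q ^ 2)) := by
  obtain ⟨K, hK0, hK⟩ := korn_half
  refine ⟨2 * K, by positivity, fun u v hu hv => ?_⟩
  have huy := (contDiff_dy hu).continuous
  have hE := continuous_strainSq hu hv
  have huc := hu.continuous
  have hvc := hv.continuous
  have h1 := hK u v hu hv
  have h2 := hK (fun q => 1 * u (0 + 1 * q.1, 1 + -1 * q.2))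
    (fun q => -1 * v (0 + 1 * q.1, 1 + -1 * q.2)) (by fun_prop) (by fun_prop)
  have r1 := boxInt_reflect_right (a := 0) (b := 1) (c := 0) (d := 1 / 2)
    (f := fun q => dy u q ^ 2) (by norm_num) (by norm_num) (by fun_prop) 1
  have r2 := boxInt_reflect_right (a := 0) (b := 1) (c := 0) (d := 1)
    (f := fun q => strainSq u v q + (u q ^ 2 + v q ^ 2)) (by norm_num) (by norm_num)
    (by fun_prop) 1
  have hs := boxInt_split_right (a := 0) (m := 1 / 2) (b := 1) (c := 0) (d := 1)
    (f := fun q => dy u q ^ 2) (by norm_num) (by norm_num) (by norm_num) (by fun_prop)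
  have c1 : boxInt 0 1 0 (1 / 2)
      (fun q => dy (fun q => 1 * u (0 + 1 * q.1, 1 + -1 * q.2)) q ^ 2)
      = boxInt 0 1 0 (1 / 2) (fun q => dy u (q.1, 1 - q.2) ^ 2) :=
    boxInt_congr fun x _ y _ => by rw [dy_affine hu]; ring_nf
  have c2 : boxInt 0 1 0 1 (fun q => strainSq (fun q => 1 * u (0 + 1 * q.1, 1 + -1 * q.2))
        (fun q => -1 * v (0 + 1 * q.1, 1 + -1 * q.2)) q
        + ((1 * u (0 + 1 * q.1, 1 + -1 * q.2)) ^ 2 + (-1 * v (0 + 1 * q.1, 1 + -1 * q.2)) ^ 2))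
      = boxInt 0 1 0 1 (fun q => strainSq u v (q.1, 1 - q.2)
        + (u (q.1, 1 - q.2) ^ 2 + v (q.1, 1 - q.2) ^ 2)) :=
    boxInt_congr fun x _ y _ => by
      unfold strainSq
      rw [dx_affine hu, dy_affine hu, dx_affine hv, dy_affine hv]; ring_nf
  rw [c1, c2, r1, r2] at h2
  norm_num at h2 hs h1 ⊢
  linarith

end Cutoff

section RigidMotion

lemma sq_integral_le {f : ℝ → ℝ} (hf : Continuous f) :
    (∫ t in (0 : ℝ)..1, f t) ^ 2 ≤ ∫ t in (0 : ℝ)..1, f t ^ 2 := by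
  set m := ∫ t in (0 : ℝ)..1, f t with hm
  have h : 0 ≤ ∫ t in (0 : ℝ)..1, (f t - m) ^ 2 :=
    intervalIntegral.integral_nonneg zero_le_one fun t _ => sq_nonneg _
  have e : ∀ t, (f t - m) ^ 2 = f t ^ 2 - (2 * m * f t - m ^ 2) := fun t => by ring
  simp_rw [e] at h
  rw [intervalIntegral.integral_sub, intervalIntegral.integral_sub,
    intervalIntegral.integral_const_mul, ← hm] at h
  · simp at h; nlinarith
  all_goals exact Continuous.intervalIntegrable (by fun_prop) _ _

lemma sq_boxInt_le {f : ℝ × ℝ → ℝ} (hf : Continuous f) :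
    boxInt 0 1 0 1 f ^ 2 ≤ boxInt 0 1 0 1 (fun q => f q ^ 2) := by
  rw [boxInt_eq zero_le_one zero_le_one hf, boxInt_eq zero_le_one zero_le_one (by fun_prop)]
  refine (sq_integral_le (continuous_integral_right hf 0 1)).trans ?_
  refine intervalIntegral.integral_mono_on zero_le_one ?_ ?_ fun x _ =>
    sq_integral_le (f := fun y => f (x, y)) (by fun_prop)
  · exact ((continuous_integral_right hf 0 1).pow 2).intervalIntegrable _ _
  · exact (continuous_integral_right (f := fun q => f q ^ 2) (by fun_prop) 0 1).intervalIntegrable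
      _ _

lemma sq_sub_le_integral {g g' : ℝ → ℝ} (hg : ∀ t, HasDerivAt g (g' t) t) (hg' : Continuous g')
    {s t : ℝ} (hs : s ∈ Set.Icc (0 : ℝ) 1) (ht : t ∈ Set.Icc (0 : ℝ) 1) :
    (g t - g s) ^ 2 ≤ ∫ r in (0 : ℝ)..1, g' r ^ 2 := by
  wlog hst : s ≤ t generalizing s t
  · rw [← neg_sub, neg_sq]; exact this ht hs (le_of_not_ge hst)
  have h1 : g t - g s = ∫ r in s..t, g' r :=
    (intervalIntegral.integral_eq_sub_of_hasDerivAt (fun r _ => hg r)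
      (hg'.intervalIntegrable _ _)).symm
  have h2 : |g t - g s| ≤ ∫ r in (0 : ℝ)..1, |g' r| := by
    rw [h1]
    refine (intervalIntegral.abs_integral_le_integral_abs hst).trans ?_
    exact intervalIntegral.integral_mono_interval hs.1 hst ht.2
      (Filter.Eventually.of_forall fun r => abs_nonneg _) (hg'.abs.intervalIntegrable _ _)
  have h3 := sq_integral_le hg'.abs
  simp only [sq_abs] at h3
  refine le_trans ?_ h3
  rw [← sq_abs (g t - g s)]
  exact pow_le_pow_left₀ (abs_nonneg _) h2 2

/-- A pointwise Poincaré inequality on `[0, 1]` with a weighted mean. -/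
lemma sq_sub_weighted_mean_le {g g' w : ℝ → ℝ} (hg : ∀ t, HasDerivAt g (g' t) t)
    (hg' : Continuous g') (hw : Continuous w) (hw0 : ∀ t ∈ Set.Icc (0 : ℝ) 1, 0 ≤ w t)
    (hw1 : ∫ t in (0 : ℝ)..1, w t = 1) {t : ℝ} (ht : t ∈ Set.Icc (0 : ℝ) 1) :
    (g t - ∫ s in (0 : ℝ)..1, w s * g s) ^ 2 ≤ ∫ r in (0 : ℝ)..1, g' r ^ 2 := by
  have hgc : Continuous g := continuous_iff_continuousAt.2 fun s => (hg s).continuousAt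
  set I := ∫ r in (0 : ℝ)..1, g' r ^ 2
  have hI0 : 0 ≤ I := intervalIntegral.integral_nonneg zero_le_one fun _ _ => sq_nonneg _
  have h1 : ∀ s ∈ Set.Icc (0 : ℝ) 1, |g t - g s| ≤ √I := fun s hs =>
    Real.abs_le_sqrt (sq_sub_le_integral hg hg' hs ht)
  have e : g t - ∫ s in (0 : ℝ)..1, w s * g s = ∫ s in (0 : ℝ)..1, w s * (g t - g s) := by
    simp_rw [mul_sub]
    rw [intervalIntegral.integral_sub, intervalIntegral.integral_mul_const, hw1, one_mul]
    all_goals exact Continuous.intervalIntegrable (by fun_prop) _ _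
  have h2 : |g t - ∫ s in (0 : ℝ)..1, w s * g s| ≤ √I := by
    rw [e]
    calc _ ≤ ∫ s in (0 : ℝ)..1, |w s * (g t - g s)| :=
          intervalIntegral.abs_integral_le_integral_abs zero_le_one
      _ ≤ ∫ s in (0 : ℝ)..1, w s * √I := by
          refine intervalIntegral.integral_mono_on zero_le_one ?_ ?_ fun s hs => ?_
          · exact Continuous.intervalIntegrable (by fun_prop) _ _
          · exact Continuous.intervalIntegrable (by fun_prop) _ _
          · rw [abs_mul, abs_of_nonneg (hw0 s hs)]
            exact mul_le_mul_of_nonneg_left (h1 s hs) (hw0 s hs)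
      _ = √I := by rw [intervalIntegral.integral_mul_const, hw1, one_mul]
  rw [← sq_abs, ← Real.sq_sqrt hI0]
  exact pow_le_pow_left₀ (abs_nonneg _) h2 2

lemma hasDerivAt_integral_left {f : ℝ × ℝ → ℝ} (hf : ContDiff ℝ (⊤ : ℕ∞) f) (a b y : ℝ) :
    HasDerivAt (fun y => ∫ x in a..b, f (x, y)) (∫ x in a..b, dy f (x, y)) y := by
  have hc := hf.continuous
  have hd := (contDiff_dy hf).continuous
  obtain ⟨M, hM⟩ := (isCompact_uIcc (a := a) (b := b)).prod
    (isCompact_Icc (a := y - 1) (b := y + 1)) |>.bddAbove_image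
    (f := fun q => ‖dy f q‖) (by fun_prop)
  refine (intervalIntegral.hasDerivAt_integral_of_dominated_loc_of_deriv_le
    (F := fun y x => f (x, y)) (F' := fun y x => dy f (x, y)) (bound := fun _ => M)
    (s := Set.Icc (y - 1) (y + 1)) (Icc_mem_nhds (by linarith) (by linarith))
    ?_ ?_ ?_ ?_ ?_ ?_).2
  · exact Filter.Eventually.of_forall fun z =>
      (Continuous.aestronglyMeasurable (by fun_prop))
  · exact Continuous.intervalIntegrable (by fun_prop) _ _
  · exact Continuous.aestronglyMeasurable (by fun_prop)
  · refine Filter.Eventually.of_forall fun x hx z hz => ?_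
    exact hM (Set.mem_image_of_mem _ ⟨Set.uIoc_subset_uIcc hx, hz⟩)
  · exact intervalIntegrable_const
  · exact Filter.Eventually.of_forall fun x _ z _ => hasDerivAt_dy hf x z

/-- The first component is affine in `y` up to the strain, in the `L²` sense. -/
lemma exists_affine_approx {u v : ℝ × ℝ → ℝ} (hu : ContDiff ℝ (⊤ : ℕ∞) u)
    (hv : ContDiff ℝ (⊤ : ℕ∞) v) :
    ∃ c : ℝ, boxInt 0 1 0 1
        (fun q => (u q - c - boxInt 0 1 0 1 (fun r => (6 - 12 * r.1) * v r) * q.2) ^ 2)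
      ≤ 144 * boxInt 0 1 0 1 (strainSq u v) := by
  have hux := (contDiff_dx hu).continuous
  have huy := (contDiff_dy hu).continuous
  have hvx := (contDiff_dx hv).continuous
  have hvy := (contDiff_dy hv).continuous
  have huc := hu.continuous
  have hvc := hv.continuous
  set ω := boxInt 0 1 0 1 (fun r => (6 - 12 * r.1) * v r) with hω
  set A : ℝ → ℝ := fun y => ∫ x in (0 : ℝ)..1, 6 * x * (1 - x) * u (x, y) with hA
  set B : ℝ → ℝ := fun y => ∫ x in (0 : ℝ)..1, (6 - 12 * x) * v (x, y) with hB
  set A' : ℝ → ℝ := fun y => ∫ x in (0 : ℝ)..1, 6 * x * (1 - x) * dy u (x, y) with hA'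
  set B' : ℝ → ℝ := fun y => ∫ x in (0 : ℝ)..1, (6 - 12 * x) * dy v (x, y) with hB'
  set D : ℝ → ℝ := fun y => ∫ x in (0 : ℝ)..1, 6 * x * (1 - x) * (dy u (x, y) + dx v (x, y))
    with hD
  have hAc : Continuous A :=
    continuous_integral_left (f := fun q => 6 * q.1 * (1 - q.1) * u q) (by fun_prop) 0 1
  have hBc : Continuous B :=
    continuous_integral_left (f := fun q => (6 - 12 * q.1) * v q) (by fun_prop) 0 1
  have hA'c : Continuous A' :=
    continuous_integral_left (f := fun q => 6 * q.1 * (1 - q.1) * dy u q) (by fun_prop) 0 1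
  have hB'c : Continuous B' :=
    continuous_integral_left (f := fun q => (6 - 12 * q.1) * dy v q) (by fun_prop) 0 1
  have hDc : Continuous D := continuous_integral_left
    (f := fun q => 6 * q.1 * (1 - q.1) * (dy u q + dx v q)) (by fun_prop) 0 1
  have hAd : ∀ y, HasDerivAt A (A' y) y := fun y => by
    have h := hasDerivAt_integral_left (f := fun q => 6 * q.1 * (1 - q.1) * u q)
      (by fun_prop) 0 1 y
    convert h using 1
    refine intervalIntegral.integral_congr fun x _ => ?_
    exact (dy_eq_of_hasDerivAt (by fun_prop)
      ((hasDerivAt_dy hu x y).const_mul (6 * x * (1 - x)))).symm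
  have hBd : ∀ y, HasDerivAt B (B' y) y := fun y => by
    have h := hasDerivAt_integral_left (f := fun q => (6 - 12 * q.1) * v q)
      (by fun_prop) 0 1 y
    convert h using 1
    refine intervalIntegral.integral_congr fun x _ => ?_
    exact (dy_eq_of_hasDerivAt (by fun_prop)
      ((hasDerivAt_dy hv x y).const_mul (6 - 12 * x))).symm
  have hωB : ω = ∫ y in (0 : ℝ)..1, B y := boxInt_eq' zero_le_one zero_le_one (by fun_prop)
  have hABD : ∀ y, A' y = D y + B y := fun y => by
    have hz : (∫ x in (0 : ℝ)..1,
        ((6 - 12 * x) * v (x, y) + 6 * x * (1 - x) * dx v (x, y))) = 0 := by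
      rw [intervalIntegral.integral_eq_sub_of_hasDerivAt
        (f := fun x => 6 * x * (1 - x) * v (x, y))]
      · simp
      · intro x _
        have h6 : HasDerivAt (fun x : ℝ => 6 * x * (1 - x)) (6 - 12 * x) x :=
          (((hasDerivAt_id x).const_mul 6).mul ((hasDerivAt_id x).const_sub 1)).congr_deriv
            (by simp; ring)
        exact h6.mul (hasDerivAt_dx hv x y)
      · exact Continuous.intervalIntegrable (by fun_prop) _ _
    rw [← add_zero (A' y), ← hz]
    simp only [hA', hD, hB]
    rw [← intervalIntegral.integral_add, ← intervalIntegral.integral_add]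
    · exact intervalIntegral.integral_congr fun x _ => by ring
    all_goals exact Continuous.intervalIntegrable (by fun_prop) _ _
  have hBω : ∀ y ∈ Set.Icc (0 : ℝ) 1,
      (B y - ω) ^ 2 ≤ 36 * boxInt 0 1 0 1 (fun q => dy v q ^ 2) := fun y hy => by
    have h := sq_sub_weighted_mean_le (w := fun _ => 1) hBd hB'c continuous_const
      (fun _ _ => zero_le_one) (by simp) hy
    simp only [one_mul, ← hωB] at h
    refine h.trans ?_
    rw [← boxInt_const_mul, boxInt_eq' zero_le_one zero_le_one (by fun_prop)]
    refine intervalIntegral.integral_mono_on zero_le_one ?_ ?_ fun z _ => ?_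
    · exact (hB'c.pow 2).intervalIntegrable _ _
    · exact (continuous_integral_left (f := fun q => 36 * dy v q ^ 2) (by fun_prop)
        0 1).intervalIntegrable _ _
    refine (sq_integral_le (f := fun x => (6 - 12 * x) * dy v (x, z)) (by fun_prop)).trans ?_
    refine intervalIntegral.integral_mono_on zero_le_one ?_ ?_ fun x hx => ?_
    · exact Continuous.intervalIntegrable (by fun_prop) _ _
    · exact Continuous.intervalIntegrable (by fun_prop) _ _
    rw [mul_pow]
    exact mul_le_mul_of_nonneg_right (by nlinarith [hx.1, hx.2]) (sq_nonneg _)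
  have hD2 : (∫ y in (0 : ℝ)..1, D y ^ 2)
      ≤ 4 * boxInt 0 1 0 1 (fun q => (dy u q + dx v q) ^ 2) := by
    rw [← boxInt_const_mul, boxInt_eq' zero_le_one zero_le_one (by fun_prop)]
    refine intervalIntegral.integral_mono_on zero_le_one ?_ ?_ fun z _ => ?_
    · exact (hDc.pow 2).intervalIntegrable _ _
    · exact (continuous_integral_left (f := fun q => 4 * (dy u q + dx v q) ^ 2) (by fun_prop)
        0 1).intervalIntegrable _ _
    refine (sq_integral_le (f := fun x => 6 * x * (1 - x) * (dy u (x, z) + dx v (x, z)))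
      (by fun_prop)).trans ?_
    refine intervalIntegral.integral_mono_on zero_le_one ?_ ?_ fun x hx => ?_
    · exact Continuous.intervalIntegrable (by fun_prop) _ _
    · exact Continuous.intervalIntegrable (by fun_prop) _ _
    rw [mul_pow]
    have h0 : 0 ≤ 6 * x * (1 - x) := by nlinarith [hx.1, hx.2]
    have h1 : 6 * x * (1 - x) ≤ 2 := by nlinarith [sq_nonneg (2 * x - 1)]
    exact mul_le_mul_of_nonneg_right (by nlinarith) (sq_nonneg _)
  set c := ∫ y in (0 : ℝ)..1, (A y - ω * y) with hc
  have hAc' : ∀ y ∈ Set.Icc (0 : ℝ) 1, (A y - ω * y - c) ^ 2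
      ≤ 8 * boxInt 0 1 0 1 (fun q => (dy u q + dx v q) ^ 2)
        + 72 * boxInt 0 1 0 1 (fun q => dy v q ^ 2) := fun y hy => by
    have h := sq_sub_weighted_mean_le (w := fun _ => 1) (g := fun y => A y - ω * y)
      (g' := fun y => A' y - ω)
      (fun t => ((hAd t).sub ((hasDerivAt_id t).const_mul ω)).congr_deriv (by simp))
      (by fun_prop) continuous_const (fun _ _ => zero_le_one) (by simp) hy
    simp only [one_mul, ← hc] at h
    refine h.trans ?_
    calc (∫ r in (0 : ℝ)..1, (A' r - ω) ^ 2)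
        ≤ ∫ r in (0 : ℝ)..1, (2 * D r ^ 2 + 72 * boxInt 0 1 0 1 (fun q => dy v q ^ 2)) := by
          refine intervalIntegral.integral_mono_on zero_le_one ?_ ?_ fun z hz => ?_
          · exact Continuous.intervalIntegrable (by fun_prop) _ _
          · exact Continuous.intervalIntegrable (by fun_prop) _ _
          have := hBω z hz
          rw [hABD]
          nlinarith [sq_nonneg (D z - (B z - ω))]
      _ = 2 * (∫ r in (0 : ℝ)..1, D r ^ 2) + 72 * boxInt 0 1 0 1 (fun q => dy v q ^ 2) := by
          rw [intervalIntegral.integral_add, intervalIntegral.integral_const_mul]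
          · simp
          all_goals exact Continuous.intervalIntegrable (by fun_prop) _ _
      _ ≤ _ := by linarith
  have huA : ∀ x ∈ Set.Icc (0 : ℝ) 1, ∀ y, (u (x, y) - A y) ^ 2
      ≤ ∫ t in (0 : ℝ)..1, dx u (t, y) ^ 2 := fun x hx y => by
    refine sq_sub_weighted_mean_le (w := fun x => 6 * x * (1 - x)) (g := fun x => u (x, y))
      (g' := fun x => dx u (x, y)) (fun t => hasDerivAt_dx hu t y) (by fun_prop) (by fun_prop)
      (fun t ht => by nlinarith [ht.1, ht.2]) ?_ hx
    rw [intervalIntegral.integral_eq_sub_of_hasDerivAt (f := fun x => 3 * x ^ 2 - 2 * x ^ 3)]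
    · norm_num
    · intro x _
      exact (((hasDerivAt_pow 2 x).const_mul 3).sub
        ((hasDerivAt_pow 3 x).const_mul 2)).congr_deriv (by simp; ring)
    · exact Continuous.intervalIntegrable (by fun_prop) _ _
  have hIc : Continuous fun y => ∫ t in (0 : ℝ)..1, dx u (t, y) ^ 2 :=
    continuous_integral_left (f := fun q => dx u q ^ 2) (by fun_prop) 0 1
  have hIbox : boxInt 0 1 0 1 (fun q => ∫ t in (0 : ℝ)..1, dx u (t, q.2) ^ 2)
      = boxInt 0 1 0 1 (fun q => dx u q ^ 2) := by
    rw [boxInt_eq' zero_le_one zero_le_one (by fun_prop),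
      boxInt_eq' zero_le_one zero_le_one (by fun_prop)]
    simp
  refine ⟨c, ?_⟩
  set S := boxInt 0 1 0 1 (fun q => (dy u q + dx v q) ^ 2) with hS
  set V := boxInt 0 1 0 1 (fun q => dy v q ^ 2) with hV
  have hS0 : 0 ≤ S := boxInt_nonneg fun q => sq_nonneg _
  have hU0 : 0 ≤ boxInt 0 1 0 1 (fun q => dx u q ^ 2) := boxInt_nonneg fun q => sq_nonneg _
  have hE : boxInt 0 1 0 1 (strainSq u v) = boxInt 0 1 0 1 (fun q => dx u q ^ 2) + S + V := by
    rw [hS, hV, ← boxInt_add (by fun_prop) (by fun_prop), ← boxInt_add (by fun_prop) (by fun_prop)]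
    rfl
  calc boxInt 0 1 0 1 (fun q => (u q - c - ω * q.2) ^ 2)
      ≤ boxInt 0 1 0 1 (fun q => 2 * (∫ t in (0 : ℝ)..1, dx u (t, q.2) ^ 2)
          + 2 * (8 * S + 72 * V)) := by
        refine boxInt_mono (by fun_prop) (by fun_prop) fun x hx y hy => ?_
        have h1 := huA x hx y
        have h2 := hAc' y hy
        simp only
        nlinarith [sq_nonneg ((u (x, y) - A y) - (A y - ω * y - c))]
    _ = 2 * boxInt 0 1 0 1 (fun q => dx u q ^ 2) + 2 * (8 * S + 72 * V) := by
        rw [boxInt_add (by fun_prop) (by fun_prop), boxInt_const_mul, hIbox,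
          boxInt_const zero_le_one zero_le_one]
        ring
    _ ≤ _ := by rw [hE]; linarith

end RigidMotion

section KornRectangle

variable {u v : ℝ × ℝ → ℝ}

lemma strainSq_swap (hu : ContDiff ℝ (⊤ : ℕ∞) u) (hv : ContDiff ℝ (⊤ : ℕ∞) v) (x y : ℝ) :
    strainSq (fun q => v (q.2, q.1)) (fun q => u (q.2, q.1)) (x, y) = strainSq u v (y, x) := by
  unfold strainSq
  rw [dx_eq_of_hasDerivAt (f := fun q => v (q.2, q.1)) (by fun_prop) (hasDerivAt_dy hv y x),
    dy_eq_of_hasDerivAt (f := fun q => v (q.2, q.1)) (by fun_prop) (hasDerivAt_dx hv y x),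
    dx_eq_of_hasDerivAt (f := fun q => u (q.2, q.1)) (by fun_prop) (hasDerivAt_dy hu y x),
    dy_eq_of_hasDerivAt (f := fun q => u (q.2, q.1)) (by fun_prop) (hasDerivAt_dx hu y x)]
  ring

/-- In `L²`, a vector field on the unit square is a linearized rigid motion up to the strain. -/
lemma exists_rigid_approx (hu : ContDiff ℝ (⊤ : ℕ∞) u) (hv : ContDiff ℝ (⊤ : ℕ∞) v) :
    ∃ c₁ c₂ ω : ℝ, boxInt 0 1 0 1
        (fun q => (u q - c₁ - ω * q.2) ^ 2 + (v q - c₂ + ω * q.1) ^ 2)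
      ≤ 12000 * boxInt 0 1 0 1 (strainSq u v) := by
  have huc := hu.continuous
  have hvc := hv.continuous
  have hE := continuous_strainSq hu hv
  obtain ⟨c₁, h1⟩ := exists_affine_approx hu hv
  obtain ⟨c₂, h2⟩ := exists_affine_approx (u := fun q => v (q.2, q.1))
    (v := fun q => u (q.2, q.1)) (by fun_prop) (by fun_prop)
  set ω := boxInt 0 1 0 1 (fun r => (6 - 12 * r.1) * v r) with hω
  set ω' := boxInt 0 1 0 1 (fun r => (6 - 12 * r.1) * u (r.2, r.1)) with hω'
  have e1 : boxInt 0 1 0 1 (strainSq (fun q => v (q.2, q.1)) (fun q => u (q.2, q.1)))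
      = boxInt 0 1 0 1 (strainSq u v) := by
    rw [boxInt_swap (f := strainSq u v) zero_le_one zero_le_one hE]
    exact boxInt_congr fun x _ y _ => strainSq_swap hu hv x y
  rw [e1, boxInt_swap zero_le_one zero_le_one (by fun_prop)] at h2
  rw [boxInt_swap zero_le_one zero_le_one (by fun_prop)] at hω'
  simp only [Prod.mk.eta] at h2 hω'
  have hz : boxInt 0 1 0 1 (fun q => (6 - 12 * q.2) * (c₁ + ω * q.2)) = -ω := by
    rw [boxInt_eq zero_le_one zero_le_one (by fun_prop)]
    have : ∀ x : ℝ, (∫ y in (0 : ℝ)..1, (6 - 12 * y) * (c₁ + ω * y)) = -ω := fun x => by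
      rw [intervalIntegral.integral_eq_sub_of_hasDerivAt
        (f := fun y => c₁ * (6 * y - 6 * y ^ 2) + ω * (3 * y ^ 2 - 4 * y ^ 3))]
      · norm_num
      · intro y _
        have a1 := (((hasDerivAt_id y).const_mul 6).sub
          ((hasDerivAt_pow 2 y).const_mul 6)).const_mul c₁
        have a2 := (((hasDerivAt_pow 2 y).const_mul 3).sub
          ((hasDerivAt_pow 3 y).const_mul 4)).const_mul ω
        exact (a1.add a2).congr_deriv (by simp; ring)
      · exact Continuous.intervalIntegrable (by fun_prop) _ _
    simp [this 0]
  have hsum : ω' + ω = boxInt 0 1 0 1 (fun q => (6 - 12 * q.2) * (u q - c₁ - ω * q.2)) := by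
    have : boxInt 0 1 0 1 (fun q => (6 - 12 * q.2) * (u q - c₁ - ω * q.2))
        = boxInt 0 1 0 1 (fun q => (6 - 12 * q.2) * u q)
          - boxInt 0 1 0 1 (fun q => (6 - 12 * q.2) * (c₁ + ω * q.2)) := by
      rw [← boxInt_sub (by fun_prop) (by fun_prop)]
      exact boxInt_congr fun x _ y _ => by ring
    rw [this, hz, ← hω']
    ring
  have hsq : (ω' + ω) ^ 2 ≤ 36 * boxInt 0 1 0 1 (fun q => (u q - c₁ - ω * q.2) ^ 2) := by
    rw [hsum, ← boxInt_const_mul]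
    refine (sq_boxInt_le (by fun_prop)).trans (boxInt_mono (by fun_prop) (by fun_prop) ?_)
    intro x _ y hy
    rw [mul_pow]
    exact mul_le_mul_of_nonneg_right (by nlinarith [hy.1, hy.2]) (sq_nonneg _)
  have hE0 : 0 ≤ boxInt 0 1 0 1 (strainSq u v) := boxInt_nonneg (strainSq_nonneg u v)
  refine ⟨c₁, c₂, ω, ?_⟩
  calc boxInt 0 1 0 1 (fun q => (u q - c₁ - ω * q.2) ^ 2 + (v q - c₂ + ω * q.1) ^ 2)
      ≤ boxInt 0 1 0 1 (fun q => (u q - c₁ - ω * q.2) ^ 2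
          + (2 * (v q - c₂ - ω' * q.1) ^ 2 + 2 * (ω' + ω) ^ 2)) := by
        refine boxInt_mono (by fun_prop) (by fun_prop) fun x hx y _ => ?_
        have hx2 : x ^ 2 ≤ 1 := by nlinarith [hx.1, hx.2]
        have := mul_le_mul_of_nonneg_left hx2 (sq_nonneg (ω' + ω))
        simp only
        nlinarith [sq_nonneg ((v (x, y) - c₂ - ω' * x) - (ω' + ω) * x)]
    _ = boxInt 0 1 0 1 (fun q => (u q - c₁ - ω * q.2) ^ 2)
        + (2 * boxInt 0 1 0 1 (fun q => (v q - c₂ - ω' * q.1) ^ 2) + 2 * (ω' + ω) ^ 2) := by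
        rw [boxInt_add (by fun_prop) (by fun_prop), boxInt_add (by fun_prop) (by fun_prop),
          boxInt_const_mul, boxInt_const zero_le_one zero_le_one]
        ring
    _ ≤ _ := by linarith

/-- Korn's second inequality on the unit square. -/
lemma korn_square : ∃ K : ℝ, 0 ≤ K ∧ ∀ u v : ℝ × ℝ → ℝ,
    ContDiff ℝ (⊤ : ℕ∞) u → ContDiff ℝ (⊤ : ℕ∞) v →
    ∃ ω : ℝ, boxInt 0 1 0 1 (fun q => (dy u q - ω) ^ 2) ≤ K * boxInt 0 1 0 1 (strainSq u v) := by
  obtain ⟨K, hK0, hK⟩ := korn_square_with_lower_order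
  refine ⟨K * 12001, by positivity, fun u v hu hv => ?_⟩
  obtain ⟨c₁, c₂, ω, h⟩ := exists_rigid_approx hu hv
  have huc := hu.continuous
  have hvc := hv.continuous
  have hE := continuous_strainSq hu hv
  refine ⟨ω, ?_⟩
  have hU : ContDiff ℝ (⊤ : ℕ∞) (fun q : ℝ × ℝ => u q - c₁ - ω * q.2) := by fun_prop
  have hV : ContDiff ℝ (⊤ : ℕ∞) (fun q : ℝ × ℝ => v q - c₂ + ω * q.1) := by fun_prop
  have hUx : ∀ x y, dx (fun q => u q - c₁ - ω * q.2) (x, y) = dx u (x, y) := fun x y =>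
    dx_eq_of_hasDerivAt hU (((hasDerivAt_dx hu x y).sub_const c₁).sub_const (ω * y))
  have hUy : ∀ x y, dy (fun q => u q - c₁ - ω * q.2) (x, y) = dy u (x, y) - ω := fun x y =>
    dy_eq_of_hasDerivAt hU ((((hasDerivAt_dy hu x y).sub_const c₁).sub
      ((hasDerivAt_id y).const_mul ω)).congr_deriv (by simp))
  have hVx : ∀ x y, dx (fun q => v q - c₂ + ω * q.1) (x, y) = dx v (x, y) + ω := fun x y =>
    dx_eq_of_hasDerivAt hV ((((hasDerivAt_dx hv x y).sub_const c₂).add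
      ((hasDerivAt_id x).const_mul ω)).congr_deriv (by simp))
  have hVy : ∀ x y, dy (fun q => v q - c₂ + ω * q.1) (x, y) = dy v (x, y) := fun x y =>
    dy_eq_of_hasDerivAt hV (((hasDerivAt_dy hv x y).sub_const c₂).add_const (ω * x))
  have h1 := hK _ _ hU hV
  have l1 : boxInt 0 1 0 1 (fun q => dy (fun q => u q - c₁ - ω * q.2) q ^ 2)
      = boxInt 0 1 0 1 (fun q => (dy u q - ω) ^ 2) :=
    boxInt_congr fun x _ y _ => by rw [hUy]
  have l2 : boxInt 0 1 0 1 (fun q =>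
        strainSq (fun q => u q - c₁ - ω * q.2) (fun q => v q - c₂ + ω * q.1) q
          + ((u q - c₁ - ω * q.2) ^ 2 + (v q - c₂ + ω * q.1) ^ 2))
      = boxInt 0 1 0 1 (fun q => strainSq u v q
          + ((u q - c₁ - ω * q.2) ^ 2 + (v q - c₂ + ω * q.1) ^ 2)) :=
    boxInt_congr fun x _ y _ => by unfold strainSq; rw [hUx, hUy, hVx, hVy]; ring
  rw [l1, l2, boxInt_add hE (by fun_prop)] at h1
  calc _ ≤ _ := h1
    _ ≤ K * (12001 * boxInt 0 1 0 1 (strainSq u v)) :=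
        mul_le_mul_of_nonneg_left (by linarith) hK0
    _ = _ := by ring

/-- `K` is a constant for Korn's second inequality on all rectangles of eccentricity at most `4`. -/
def IsKornConst (K : ℝ) : Prop :=
  ∀ x₀ y₀ a b : ℝ, 0 < a → 0 < b → a ≤ 4 * b → b ≤ 4 * a →
    ∀ u v : ℝ × ℝ → ℝ, ContDiff ℝ (⊤ : ℕ∞) u → ContDiff ℝ (⊤ : ℕ∞) v →
    ∃ ω : ℝ, boxInt x₀ (x₀ + a) y₀ (y₀ + b) (fun q => (dy u q - ω) ^ 2)
      ≤ K * boxInt x₀ (x₀ + a) y₀ (y₀ + b) (strainSq u v)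

lemma exists_isKornConst : ∃ K : ℝ, 0 ≤ K ∧ IsKornConst K := by
  obtain ⟨K, hK0, hK⟩ := korn_square
  refine ⟨16 * K, by positivity, fun x₀ y₀ a b ha hb hab hba u v hu hv => ?_⟩
  have huy := (contDiff_dy hu).continuous
  have hE := continuous_strainSq hu hv
  set U : ℝ × ℝ → ℝ := fun q => a * u (x₀ + a * q.1, y₀ + b * q.2) with hUdef
  set V : ℝ × ℝ → ℝ := fun q => b * v (x₀ + a * q.1, y₀ + b * q.2) with hVdef
  have hU : ContDiff ℝ (⊤ : ℕ∞) U := by fun_prop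
  have hV : ContDiff ℝ (⊤ : ℕ∞) V := by fun_prop
  obtain ⟨ω, h⟩ := hK U V hU hV
  refine ⟨ω / (a * b), ?_⟩
  have c1 := boxInt_comp_affine (a := 0) (b := 1) (c := 0) (d := 1)
    (f := fun q => (dy u q - ω / (a * b)) ^ 2) zero_le_one zero_le_one (by fun_prop) (x₀ := x₀)
    (y₀ := y₀) ha hb
  have c2 := boxInt_comp_affine (a := 0) (b := 1) (c := 0) (d := 1)
    (f := strainSq u v) zero_le_one zero_le_one (by fun_prop) (x₀ := x₀) (y₀ := y₀) ha hb
  have d1 : boxInt 0 1 0 1 (fun q => (dy U q - ω) ^ 2) = (a * b) ^ 2 *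
      boxInt 0 1 0 1 (fun q => (dy u (x₀ + a * q.1, y₀ + b * q.2) - ω / (a * b)) ^ 2) := by
    rw [← boxInt_const_mul]
    refine boxInt_congr fun x _ y _ => ?_
    rw [dy_affine hu]; field_simp
  have d2 : boxInt 0 1 0 1 (strainSq U V) ≤ (a * b) ^ 2 *
      (16 * boxInt 0 1 0 1 (fun q => strainSq u v (x₀ + a * q.1, y₀ + b * q.2))) := by
    rw [← boxInt_const_mul, ← boxInt_const_mul]
    refine boxInt_mono (continuous_strainSq hU hV) (by fun_prop) fun x _ y _ => ?_
    unfold strainSq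
    rw [hUdef, hVdef, dx_affine hu, dy_affine hu, dx_affine hv, dy_affine hv]
    set α := dx u (x₀ + a * x, y₀ + b * y)
    set β := dy u (x₀ + a * x, y₀ + b * y)
    set γ := dx v (x₀ + a * x, y₀ + b * y)
    set δ := dy v (x₀ + a * x, y₀ + b * y)
    have e1 : (a * a) ^ 2 ≤ (a * b) ^ 2 * 16 := by
      have : a * a ≤ a * b * 4 := by nlinarith
      calc (a * a) ^ 2 ≤ (a * b * 4) ^ 2 := pow_le_pow_left₀ (by positivity) this 2
        _ = _ := by ring
    have e2 : (b * b) ^ 2 ≤ (a * b) ^ 2 * 16 := by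
      have : b * b ≤ a * b * 4 := by nlinarith
      calc (b * b) ^ 2 ≤ (a * b * 4) ^ 2 := pow_le_pow_left₀ (by positivity) this 2
        _ = _ := by ring
    have g1 := mul_le_mul_of_nonneg_right e1 (sq_nonneg α)
    have g2 := mul_le_mul_of_nonneg_right e2 (sq_nonneg δ)
    have g3 : 0 ≤ (a * b) ^ 2 * (β + γ) ^ 2 := by positivity
    linarith
  simp only [mul_zero, add_zero, mul_one] at c1 c2
  rw [d1, c1] at h
  rw [c2] at d2
  have hab0 : 0 < a * b := by positivity
  set I := boxInt x₀ (x₀ + a) y₀ (y₀ + b) (fun q => (dy u q - ω / (a * b)) ^ 2)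
  set J := boxInt x₀ (x₀ + a) y₀ (y₀ + b) (strainSq u v)
  have h' : (a * b) ^ 2 * ((a * b)⁻¹ * I) ≤ K * ((a * b) ^ 2 * (16 * ((a * b)⁻¹ * J))) :=
    h.trans (mul_le_mul_of_nonneg_left d2 hK0)
  have e1 : (a * b) ^ 2 * ((a * b)⁻¹ * I) = (a * b) * I := by field_simp
  have e2 : K * ((a * b) ^ 2 * (16 * ((a * b)⁻¹ * J))) = (a * b) * (16 * K * J) := by field_simp
  rw [e1, e2] at h'
  exact le_of_mul_le_mul_left h' hab0

end KornRectangle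

section Discrete

lemma abs_sub_le_sum_abs_sub (f : ℕ → ℝ) {m i j : ℕ} (hi : i ≤ m) (hj : j ≤ m) :
    |f i - f j| ≤ ∑ k ∈ Finset.range m, |f (k + 1) - f k| := by
  have key : ∀ i j : ℕ, i ≤ j → j ≤ m →
      |f i - f j| ≤ ∑ k ∈ Finset.range m, |f (k + 1) - f k| := fun i j hij hjm => by
    have h := dist_le_Ico_sum_dist f hij
    simp only [Real.dist_eq] at h
    refine h.trans ?_
    simp only [fun k => abs_sub_comm (f k) (f (k + 1))]
    refine Finset.sum_le_sum_of_subset_of_nonneg (fun k hk => ?_) fun _ _ _ => abs_nonneg _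
    simp only [Finset.mem_Ico, Finset.mem_range] at hk ⊢
    omega
  rcases le_total i j with h | h
  · exact key i j h hj
  · rw [abs_sub_comm]; exact key j i h hi

lemma abs_mul_abs_sub_le (x y : ℝ) : |(x * |x|) - (y * |y|)| ≤ (|x| + |y|) * |x - y| := by
  have e : x * |x| - y * |y| = (x - y) * |x| + y * (|x| - |y|) := by ring
  rw [e]
  refine (abs_add_le _ _).trans ?_
  rw [abs_mul, abs_mul, abs_abs]
  nlinarith [abs_abs_sub_abs_le_abs_sub x y, abs_nonneg y]

lemma sum_mul_abs_le (g c : ℕ → ℝ) (m : ℕ) :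
    ∑ k ∈ Finset.range m, (|g (k + 1)| + |g k|) * |c k|
      ≤ 2 * √(∑ k ∈ Finset.range (m + 1), g k ^ 2) * √(∑ k ∈ Finset.range m, c k ^ 2) := by
  have h1 : ∑ k ∈ Finset.range m, (|g (k + 1)| + |g k|) ^ 2
      ≤ 4 * ∑ k ∈ Finset.range (m + 1), g k ^ 2 := by
    have a1 := Finset.sum_range_succ (fun k => g k ^ 2) m
    have a2 := Finset.sum_range_succ' (fun k => g k ^ 2) m
    have a3 : ∑ k ∈ Finset.range m, (|g (k + 1)| + |g k|) ^ 2
        ≤ ∑ k ∈ Finset.range m, (2 * g (k + 1) ^ 2 + 2 * g k ^ 2) := by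
      refine Finset.sum_le_sum fun k _ => ?_
      nlinarith [sq_nonneg (|g (k + 1)| - |g k|), sq_abs (g (k + 1)), sq_abs (g k)]
    rw [Finset.sum_add_distrib, ← Finset.mul_sum, ← Finset.mul_sum] at a3
    nlinarith [sq_nonneg (g m), sq_nonneg (g 0)]
  have h2 := Finset.sum_mul_sq_le_sq_mul_sq (Finset.range m)
    (fun k => |g (k + 1)| + |g k|) (fun k => |c k|)
  simp only [sq_abs] at h2
  have hA : 0 ≤ ∑ k ∈ Finset.range (m + 1), g k ^ 2 := Finset.sum_nonneg fun _ _ => sq_nonneg _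
  have hC : 0 ≤ ∑ k ∈ Finset.range m, c k ^ 2 := Finset.sum_nonneg fun _ _ => sq_nonneg _
  refine abs_le_of_sq_le_sq' ?_ (by positivity) |>.2
  rw [mul_pow, mul_pow, sq_sqrt hA, sq_sqrt hC]
  nlinarith

/-- Discrete interpolation inequality: for a sequence with equal end values, the first differences
are controlled by the values and the second differences. -/
lemma sum_sq_diff_le (a : ℕ → ℝ) (m : ℕ) (ha : a (m + 1) = a 0) :
    ∑ k ∈ Finset.range (m + 1), (a (k + 1) - a k) ^ 2
      ≤ 19 * √(∑ k ∈ Finset.range (m + 1), a k ^ 2)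
        * √(∑ k ∈ Finset.range m, ((a (k + 2) - a (k + 1)) - (a (k + 1) - a k)) ^ 2) := by
  set w : ℕ → ℝ := fun k => a (k + 1) - a k with hw
  set A := √(∑ k ∈ Finset.range (m + 1), a k ^ 2) with hA
  set D := √(∑ k ∈ Finset.range m, ((a (k + 2) - a (k + 1)) - (a (k + 1) - a k)) ^ 2) with hD
  set S := √(∑ k ∈ Finset.range (m + 1), w k ^ 2) with hS
  have hSS : ∑ k ∈ Finset.range (m + 1), w k ^ 2 = S ^ 2 :=
    (sq_sqrt (Finset.sum_nonneg fun _ _ => sq_nonneg _)).symm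
  have hAA : ∑ k ∈ Finset.range (m + 1), a k ^ 2 = A ^ 2 :=
    (sq_sqrt (Finset.sum_nonneg fun _ _ => sq_nonneg _)).symm
  have hA0 : 0 ≤ A := sqrt_nonneg _
  have hD0 : 0 ≤ D := sqrt_nonneg _
  have hS0 : 0 ≤ S := sqrt_nonneg _
  have hwS : ∀ i ≤ m, w i ^ 2 ≤ 2 * S * D := fun i hi => by
    obtain ⟨j, hj, hij⟩ : ∃ j ∈ Finset.range (m + 1), w i * w j ≤ 0 := by
      refine Finset.exists_le_of_sum_le (f := fun j => w i * w j) (g := fun _ => (0 : ℝ))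
        ⟨0, by simp⟩ ?_
      rw [← Finset.mul_sum, Finset.sum_range_sub, ha]
      simp
    have hj' : j ≤ m := by simpa [Nat.lt_succ_iff] using hj
    have h1 := abs_sub_le_sum_abs_sub (fun k => w k * |w k|) hi hj'
    have h2 : ∑ k ∈ Finset.range m, |(w (k + 1) * |w (k + 1)|) - (w k * |w k|)|
        ≤ ∑ k ∈ Finset.range m, (|w (k + 1)| + |w k|) * |w (k + 1) - w k| :=
      Finset.sum_le_sum fun k _ => abs_mul_abs_sub_le (w (k + 1)) (w k)
    have h3 := sum_mul_abs_le w (fun k => w (k + 1) - w k) m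
    have h4 : w i ^ 2 ≤ |(w i * |w i|) - (w j * |w j|)| := by
      rw [← abs_of_nonneg (sq_nonneg (w i)), ← sq_le_sq]
      have e : (w i * |w i| - w j * |w j|) ^ 2
          = (w i ^ 2) ^ 2 + (w j ^ 2) ^ 2 + 2 * (-(w i * w j)) * (|w i| * |w j|) := by
        linear_combination w i ^ 2 * sq_abs (w i) + w j ^ 2 * sq_abs (w j)
      have : 0 ≤ 2 * (-(w i * w j)) * (|w i| * |w j|) :=
        mul_nonneg (by linarith) (by positivity)
      nlinarith [sq_nonneg (w j ^ 2)]
    exact h4.trans (h1.trans (h2.trans h3))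
  have hSD : S ≤ 2 * (m + 1) * D := by
    have : S ^ 2 ≤ (m + 1) * (2 * S * D) := by
      rw [← hSS]
      refine (Finset.sum_le_card_nsmul _ _ _ fun i hi =>
        hwS i (by simpa [Nat.lt_succ_iff] using hi)).trans ?_
      simp
    rcases hS0.eq_or_lt with h | h
    · rw [← h]; positivity
    · exact le_of_mul_le_mul_left (by linarith) h
  have ha0 : (m + 1) * a 0 ^ 2 ≤ A ^ 2 + (m + 1) * (2 * A * S) := by
    have h1 : ∀ i ∈ Finset.range (m + 1), a 0 ^ 2 ≤ a i ^ 2 + 2 * A * S := fun i hi => by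
      have hi' : i ≤ m := by simpa [Nat.lt_succ_iff] using hi
      have h1 := abs_sub_le_sum_abs_sub (fun k => a k ^ 2) (Nat.zero_le m) hi'
      have h2 : ∑ k ∈ Finset.range m, |a (k + 1) ^ 2 - a k ^ 2|
          ≤ ∑ k ∈ Finset.range m, (|a (k + 1)| + |a k|) * |w k| := by
        refine Finset.sum_le_sum fun k _ => ?_
        rw [sq_sub_sq, abs_mul]
        exact mul_le_mul_of_nonneg_right (abs_add_le _ _) (abs_nonneg _)
      have h3 := sum_mul_abs_le a w m
      have h4 : √(∑ k ∈ Finset.range m, w k ^ 2) ≤ S := by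
        refine sqrt_le_sqrt ?_
        rw [Finset.sum_range_succ]
        linarith [sq_nonneg (w m)]
      have h5 := mul_le_mul_of_nonneg_left h4 (by positivity : 0 ≤ 2 * A)
      have h6 := le_abs_self (a 0 ^ 2 - a i ^ 2)
      linarith
    have := Finset.sum_le_sum h1
    rw [Finset.sum_add_distrib, hAA] at this
    simpa using this
  have hparts : S ^ 2 = a 0 * (w m - w 0)
      - ∑ k ∈ Finset.range m, a (k + 1) * ((a (k + 2) - a (k + 1)) - (a (k + 1) - a k)) := by
    have : ∀ m, ∑ k ∈ Finset.range (m + 1), w k ^ 2 = a (m + 1) * w m - a 0 * w 0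
      - ∑ k ∈ Finset.range m, a (k + 1) * ((a (k + 2) - a (k + 1)) - (a (k + 1) - a k)) := by
      intro m
      induction m with
      | zero => simp [hw]; ring
      | succ m ih =>
        rw [Finset.sum_range_succ, ih, Finset.sum_range_succ _ m]
        simp only [hw]
        ring
    rw [← hSS, this, ha]
    ring
  have hcs : |∑ k ∈ Finset.range m, a (k + 1) * ((a (k + 2) - a (k + 1)) - (a (k + 1) - a k))|
      ≤ A * D := by
    refine abs_le_of_sq_le_sq ?_ (by positivity)
    refine (Finset.sum_mul_sq_le_sq_mul_sq _ _ _).trans ?_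
    rw [mul_pow, sq_sqrt (Finset.sum_nonneg fun _ _ => sq_nonneg _),
      sq_sqrt (Finset.sum_nonneg fun _ _ => sq_nonneg _)]
    refine mul_le_mul_of_nonneg_right ?_ (Finset.sum_nonneg fun _ _ => sq_nonneg _)
    rw [Finset.sum_range_succ' _ m]
    linarith [sq_nonneg (a 0)]
  rw [hSS]
  have h1 : S ^ 2 - A * D ≤ |a 0 * (w m - w 0)| := by
    linarith [abs_le.1 hcs |>.1, le_abs_self (a 0 * (w m - w 0))]
  by_contra! hcon
  have hAD : 0 ≤ A * D := by positivity
  have h2 : (S ^ 2 - A * D) ^ 2 ≤ a 0 ^ 2 * (8 * S * D) := by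
    calc _ ≤ |a 0 * (w m - w 0)| ^ 2 := pow_le_pow_left₀ (by linarith) h1 2
      _ = a 0 ^ 2 * (w m - w 0) ^ 2 := by rw [sq_abs, mul_pow]
      _ ≤ _ := mul_le_mul_of_nonneg_left
        (by nlinarith [hwS m le_rfl, hwS 0 (Nat.zero_le m), sq_nonneg (w m + w 0)]) (sq_nonneg _)
  have hm : (0 : ℝ) < m + 1 := by positivity
  have h3 : a 0 ^ 2 * (8 * S * D) ≤ 16 * (A * D) ^ 2 + 16 * (A * D) * S ^ 2 := by
    refine le_of_mul_le_mul_left ?_ hm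
    have b1 := mul_le_mul_of_nonneg_right ha0 (by positivity : 0 ≤ 8 * S * D)
    have b2 := mul_le_mul_of_nonneg_left hSD (by positivity : 0 ≤ 8 * A ^ 2 * D)
    nlinarith
  nlinarith

end Discrete

section Strip

variable {a b c d : ℝ} {f u v : ℝ × ℝ → ℝ}

lemma boxInt_split_cells_right (hab : a ≤ b) {l : ℝ} (hl : 0 ≤ l) (hf : Continuous f) (n : ℕ) :
    boxInt a b c (c + n * l) f
      = ∑ i ∈ Finset.range n, boxInt a b (c + i * l) (c + i * l + l) f := by
  induction n with
  | zero => simpa using boxInt_split_right (m := c) le_rfl le_rfl hab hf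
  | succ n ih =>
    rw [Finset.sum_range_succ, ← ih, ← boxInt_split_right (by nlinarith [n.cast_nonneg (α := ℝ)])
      (by linarith) hab hf]
    push_cast
    ring_nf

lemma boxInt_split_cells_left (hcd : c ≤ d) {l : ℝ} (hl : 0 ≤ l) (hf : Continuous f) (n : ℕ) :
    boxInt a (a + n * l) c d f
      = ∑ i ∈ Finset.range n, boxInt (a + i * l) (a + i * l + l) c d f := by
  induction n with
  | zero => simpa using boxInt_split_left (m := a) le_rfl le_rfl hcd hf
  | succ n ih =>
    rw [Finset.sum_range_succ, ← ih, ← boxInt_split_left (by nlinarith [n.cast_nonneg (α := ℝ)])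
      (by linarith) hcd hf]
    push_cast
    ring_nf

/-- Bias-variance decomposition on a rectangle. -/
lemma boxInt_sub_const_sq (hab : a < b) (hcd : c < d) (hf : Continuous f) (m ω : ℝ)
    (hm : boxInt a b c d f = (b - a) * (d - c) * m) :
    boxInt a b c d (fun q => (f q - ω) ^ 2)
      = boxInt a b c d (fun q => (f q - m) ^ 2) + (b - a) * (d - c) * (m - ω) ^ 2 := by
  have e : boxInt a b c d (fun q => (f q - ω) ^ 2) = boxInt a b c d (fun q =>
      (f q - m) ^ 2 + (2 * (m - ω) * f q + (ω ^ 2 - m ^ 2))) :=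
    boxInt_congr fun x _ y _ => by ring
  rw [e, boxInt_add (by fun_prop) (by fun_prop), boxInt_add (by fun_prop) (by fun_prop),
    boxInt_const_mul, boxInt_const hab.le hcd.le, hm]
  ring

lemma boxInt_sq_le_area (hab : a < b) (hcd : c < d) (hf : Continuous f) :
    boxInt a b c d f ^ 2 ≤ (b - a) * (d - c) * boxInt a b c d (fun q => f q ^ 2) := by
  have h0 : 0 < (b - a) * (d - c) := mul_pos (sub_pos.2 hab) (sub_pos.2 hcd)
  have h := boxInt_sub_const_sq hab hcd hf (boxInt a b c d f / ((b - a) * (d - c))) 0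
    (mul_div_cancel₀ _ h0.ne').symm
  simp only [sub_zero] at h
  rw [h, mul_add]
  have h1 : 0 ≤ boxInt a b c d (fun q => (f q - boxInt a b c d f / ((b - a) * (d - c))) ^ 2) :=
    boxInt_nonneg fun _ => sq_nonneg _
  have h2 : (b - a) * (d - c) * ((b - a) * (d - c) * (boxInt a b c d f / ((b - a) * (d - c))) ^ 2)
      = boxInt a b c d f ^ 2 := by
    generalize (b - a) * (d - c) = P at h0
    field_simp
  rw [h2]
  nlinarith

lemma boxInt_dy (hab : a ≤ b) (hcd : c ≤ d) (hu : ContDiff ℝ (⊤ : ℕ∞) u) :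
    boxInt a b c d (dy u) = (∫ x in a..b, u (x, d)) - ∫ x in a..b, u (x, c) := by
  have hc := hu.continuous
  have hd := (contDiff_dy hu).continuous
  rw [boxInt_eq' hab hcd hd]
  exact intervalIntegral.integral_eq_sub_of_hasDerivAt
    (fun y _ => hasDerivAt_integral_left hu a b y)
    ((continuous_integral_left hd a b).intervalIntegrable _ _)

/-- A trace inequality for horizontal averages. -/
lemma sq_integral_bottom_le {l : ℝ} (hab : a < b) (hl : 0 < l) (hu : ContDiff ℝ (⊤ : ℕ∞) u) :
    l * (∫ x in a..b, u (x, c)) ^ 2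
      ≤ 2 * (b - a) * (boxInt a b c (c + l) (fun q => u q ^ 2)
        + l ^ 2 * boxInt a b c (c + l) (fun q => dy u q ^ 2)) := by
  have hc := hu.continuous
  have hd := (contDiff_dy hu).continuous
  have hcl : c < c + l := by linarith
  set W : ℝ × ℝ → ℝ := fun q => (c + l - q.2) * u q with hW
  have hWs : ContDiff ℝ (⊤ : ℕ∞) W := by fun_prop
  have hWy : ∀ x y, dy W (x, y) = (c + l - y) * dy u (x, y) - u (x, y) := fun x y =>
    dy_eq_of_hasDerivAt hWs ((((hasDerivAt_id y).const_sub (c + l)).mul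
      (hasDerivAt_dy hu x y)).congr_deriv (by simp; ring))
  have h1 := boxInt_dy hab.le hcl.le hWs
  have h2 : boxInt a b c (c + l) (dy W)
      = boxInt a b c (c + l) (fun q => (c + l - q.2) * dy u q) - boxInt a b c (c + l) u := by
    rw [← boxInt_sub (by fun_prop) hc]
    exact boxInt_congr fun x _ y _ => hWy x y
  simp only [hW, sub_self, zero_mul, intervalIntegral.integral_zero, add_sub_cancel_left,
    intervalIntegral.integral_const_mul] at h1
  rw [← hW, h2] at h1
  have h3 := boxInt_sq_le_area hab hcl hc
  have h4 := boxInt_sq_le_area hab hcl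
    (f := fun q => (c + l - q.2) * dy u q) (by fun_prop)
  have h5 : boxInt a b c (c + l) (fun q => ((c + l - q.2) * dy u q) ^ 2)
      ≤ l ^ 2 * boxInt a b c (c + l) (fun q => dy u q ^ 2) := by
    rw [← boxInt_const_mul]
    refine boxInt_mono (by fun_prop) (by fun_prop) fun x _ y hy => ?_
    rw [mul_pow]
    exact mul_le_mul_of_nonneg_right
      (pow_le_pow_left₀ (by linarith [hy.2]) (by linarith [hy.1]) 2) (sq_nonneg _)
  rw [add_sub_cancel_left] at h3 h4
  set X := boxInt a b c (c + l) (fun q => (c + l - q.2) * dy u q)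
  set Y := boxInt a b c (c + l) u
  refine le_of_mul_le_mul_left ?_ hl
  have h6 : (l * ∫ x in a..b, u (x, c)) ^ 2 ≤ 2 * X ^ 2 + 2 * Y ^ 2 := by
    have : (l * ∫ x in a..b, u (x, c)) = Y - X := by linarith
    rw [this]
    nlinarith [sq_nonneg (X + Y)]
  have h7 := mul_le_mul_of_nonneg_left h5
    (mul_nonneg (sub_nonneg.2 hab.le) hl.le)
  nlinarith

lemma exists_cells {h p : ℝ} (hh : 0 < h) (hp : h ≤ p) :
    ∃ (m : ℕ) (l : ℝ), h ≤ l ∧ l ≤ 2 * h ∧ ((m + 1 : ℕ) : ℝ) * l = p := by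
  have h1 : 1 ≤ ⌊p / h⌋₊ := (Nat.one_le_floor_iff _).2 ((one_le_div hh).2 hp)
  obtain ⟨m, hm⟩ := Nat.exists_eq_add_of_le' h1
  have h2 : (⌊p / h⌋₊ : ℝ) ≤ p / h := Nat.floor_le (div_nonneg (hh.le.trans hp) hh.le)
  have h3 := Nat.lt_floor_add_one (p / h)
  rw [hm] at h2 h3
  have hm0 : (0 : ℝ) < ((m + 1 : ℕ) : ℝ) := by positivity
  have hm1 : (1 : ℝ) ≤ ((m + 1 : ℕ) : ℝ) := by push_cast; linarith [m.cast_nonneg (α := ℝ)]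
  rw [le_div_iff₀ hh] at h2
  rw [div_lt_iff₀ hh] at h3
  refine ⟨m, p / ((m + 1 : ℕ) : ℝ), ?_, ?_, by field_simp⟩
  · rw [le_div_iff₀ hm0]; linarith
  · rw [div_le_iff₀ hm0]; nlinarith

/-- Flat rectangles: no mixed term is needed. -/
lemma strip_flat {K : ℝ} (hK : IsKornConst K)
    {x₀ h p : ℝ} (hp : 0 < p) (hph : p ≤ h)
    (hu : ContDiff ℝ (⊤ : ℕ∞) u) (hv : ContDiff ℝ (⊤ : ℕ∞) v)
    (hper : ∀ x ∈ Set.Icc x₀ (x₀ + h), u (x, 0) = u (x, p)) :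
    boxInt x₀ (x₀ + h) 0 p (fun q => dy u q ^ 2)
      ≤ K * boxInt x₀ (x₀ + h) 0 p (strainSq u v) := by
  have hd := (contDiff_dy hu).continuous
  have hE := continuous_strainSq hu hv
  obtain ⟨m, l, hl1, hl2, hml⟩ := exists_cells hp hph
  have hl : 0 < l := hp.trans_le hl1
  rw [← hml, boxInt_split_cells_left hp.le hl.le (by fun_prop),
    boxInt_split_cells_left hp.le hl.le hE, Finset.mul_sum]
  refine Finset.sum_le_sum fun i hi => ?_
  obtain ⟨ω, hω⟩ := hK (x₀ + i * l) 0 l p hl hp (by linarith) (by linarith) u v hu hv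
  rw [zero_add] at hω
  refine le_trans ?_ hω
  have hi0 : (0 : ℝ) ≤ i * l := by positivity
  have hi1 : i * l + l ≤ h := by
    have : ((i + 1 : ℕ) : ℝ) ≤ ((m + 1 : ℕ) : ℝ) := by
      exact_mod_cast Finset.mem_range.1 hi
    rw [← hml]
    calc i * l + l = ((i + 1 : ℕ) : ℝ) * l := by push_cast; ring
      _ ≤ _ := mul_le_mul_of_nonneg_right this hl.le
  have hmean : boxInt (x₀ + i * l) (x₀ + i * l + l) 0 p (dy u) = 0 := by
    rw [boxInt_dy (by linarith) hp.le hu, sub_eq_zero]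
    refine intervalIntegral.integral_congr fun x hx => ?_
    rw [Set.uIcc_of_le (by linarith)] at hx
    exact (hper x ⟨by linarith [hx.1], by linarith [hx.2]⟩).symm
  have := boxInt_sub_const_sq (by linarith) hp hd 0 ω (hmean.trans (by ring))
  simp only [sub_zero, zero_sub, neg_sq, add_sub_cancel_left] at this
  rw [this]
  have : 0 ≤ l * p * ω ^ 2 := by positivity
  linarith

end Strip

section StripTall

variable {u v : ℝ × ℝ → ℝ}

/-- The mean rotations of two stacked cells differ by at most the strain of their union. -/
lemma mean_sub_mean_sq_le {K : ℝ} (hK : IsKornConst K) {x₀ y h l M M' : ℝ} (hh : 0 < h)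
    (hl1 : h ≤ l) (hl2 : l ≤ 2 * h)
    (hu : ContDiff ℝ (⊤ : ℕ∞) u) (hv : ContDiff ℝ (⊤ : ℕ∞) v)
    (hM : boxInt x₀ (x₀ + h) y (y + l) (dy u) = h * l * M)
    (hM' : boxInt x₀ (x₀ + h) (y + l) (y + l + l) (dy u) = h * l * M') :
    h * l * (M' - M) ^ 2 ≤ 2 * K * (boxInt x₀ (x₀ + h) y (y + l) (strainSq u v)
      + boxInt x₀ (x₀ + h) (y + l) (y + l + l) (strainSq u v)) := by
  have hl : 0 < l := hh.trans_le hl1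
  have hd := (contDiff_dy hu).continuous
  have hE := continuous_strainSq hu hv
  obtain ⟨ω, hω⟩ := hK x₀ y h (l + l) hh (by positivity) (by linarith) (by linarith) u v hu hv
  rw [← add_assoc, boxInt_split_right (m := y + l) (by linarith) (by linarith) (by linarith)
    (by fun_prop), boxInt_split_right (m := y + l) (by linarith) (by linarith) (by linarith)
    hE] at hω
  have h1 := boxInt_sub_const_sq (a := x₀) (b := x₀ + h) (c := y) (d := y + l)
    (by linarith) (by linarith) hd M ω (by rw [hM]; ring)
  have h2 := boxInt_sub_const_sq (a := x₀) (b := x₀ + h) (c := y + l) (d := y + l + l)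
    (by linarith) (by linarith) hd M' ω (by rw [hM']; ring)
  have n1 : 0 ≤ boxInt x₀ (x₀ + h) y (y + l) (fun q => (dy u q - M) ^ 2) :=
    boxInt_nonneg fun _ => sq_nonneg _
  have n2 : 0 ≤ boxInt x₀ (x₀ + h) (y + l) (y + l + l) (fun q => (dy u q - M') ^ 2) :=
    boxInt_nonneg fun _ => sq_nonneg _
  simp only [add_sub_cancel_left] at h1 h2
  have h3 : h * l * (M' - M) ^ 2 ≤ 2 * (h * l * (M - ω) ^ 2) + 2 * (h * l * (M' - ω) ^ 2) := by
    have : 0 ≤ h * l * ((M' - ω) + (M - ω)) ^ 2 := by positivity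
    nlinarith
  linarith

/-- Tall rectangles, with the full derivative still on the right. -/
lemma strip_tall {K : ℝ} (hK0 : 0 ≤ K) (hK : IsKornConst K) {x₀ h p : ℝ} (hh : 0 < h) (hhp : h ≤ p)
    (hu : ContDiff ℝ (⊤ : ℕ∞) u) (hv : ContDiff ℝ (⊤ : ℕ∞) v)
    (hper : ∀ x ∈ Set.Icc x₀ (x₀ + h), u (x, 0) = u (x, p)) :
    boxInt x₀ (x₀ + h) 0 p (fun q => dy u q ^ 2)
      ≤ K * boxInt x₀ (x₀ + h) 0 p (strainSq u v)
        + 19 / h * √(2 * boxInt x₀ (x₀ + h) 0 p (fun q => u q ^ 2)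
            + 8 * h ^ 2 * boxInt x₀ (x₀ + h) 0 p (fun q => dy u q ^ 2))
          * √(8 * K * boxInt x₀ (x₀ + h) 0 p (strainSq u v)) := by
  have huc := hu.continuous
  have hd := (contDiff_dy hu).continuous
  have hE := continuous_strainSq hu hv
  obtain ⟨m, l, hl1, hl2, hml⟩ := exists_cells hh hhp
  have hl : 0 < l := hh.trans_le hl1
  have hab : x₀ < x₀ + h := by linarith
  have cells : ∀ {f : ℝ × ℝ → ℝ}, Continuous f → boxInt x₀ (x₀ + h) 0 p f
      = ∑ i ∈ Finset.range (m + 1), boxInt x₀ (x₀ + h) (i * l) (i * l + l) f := fun {f} hf => by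
    have := boxInt_split_cells_right (c := 0) hab.le hl.le hf (m + 1)
    simp only [zero_add, hml] at this
    exact this
  set a : ℕ → ℝ := fun i => ∫ x in x₀..x₀ + h, u (x, i * l) with ha
  have hnode : ∀ i : ℕ, ((i + 1 : ℕ) : ℝ) * l = i * l + l := fun i => by push_cast; ring
  have ha0 : a (m + 1) = a 0 := by
    simp only [ha, hml, Nat.cast_zero, zero_mul]
    refine intervalIntegral.integral_congr fun x hx => ?_
    rw [Set.uIcc_of_le hab.le] at hx
    exact (hper x hx).symm
  set M : ℕ → ℝ := fun i => (a (i + 1) - a i) / (h * l) with hM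
  have hdiff : ∀ i, a (i + 1) - a i = h * l * M i := fun i => by
    simp only [hM]; field_simp
  have hmean : ∀ i : ℕ, boxInt x₀ (x₀ + h) (i * l) (i * l + l) (dy u) = h * l * M i := fun i => by
    rw [boxInt_dy hab.le (by linarith) hu, ← hdiff]
    simp only [ha, hnode]
  have hdisc := sum_sq_diff_le a m ha0
  set T := boxInt x₀ (x₀ + h) 0 p (fun q => u q ^ 2) with hT
  set N := boxInt x₀ (x₀ + h) 0 p (fun q => dy u q ^ 2) with hN
  set E := boxInt x₀ (x₀ + h) 0 p (strainSq u v) with hEdef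
  have hE0 : 0 ≤ E := boxInt_nonneg (strainSq_nonneg u v)
  have hN0 : 0 ≤ N := boxInt_nonneg fun _ => sq_nonneg _
  have hT0 : 0 ≤ T := boxInt_nonneg fun _ => sq_nonneg _
  have hA : ∑ k ∈ Finset.range (m + 1), a k ^ 2 ≤ 2 * T + 8 * h ^ 2 * N := by
    have h1 : l * ∑ k ∈ Finset.range (m + 1), a k ^ 2 ≤ 2 * h * (T + l ^ 2 * N) := by
      rw [hT, hN, cells (by fun_prop), cells (by fun_prop), Finset.mul_sum, Finset.mul_sum,
        ← Finset.sum_add_distrib, Finset.mul_sum]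
      refine Finset.sum_le_sum fun k _ => ?_
      have := sq_integral_bottom_le (c := k * l) hab hl hu
      rwa [add_sub_cancel_left] at this
    refine le_of_mul_le_mul_left (h1.trans ?_) hl
    have e1 : 0 ≤ (l - h) * T := mul_nonneg (by linarith) hT0
    have e2 : 0 ≤ (2 * h - l) * (h * l * N) := mul_nonneg (by linarith) (by positivity)
    have e3 : 0 ≤ h * l * h * N := by positivity
    nlinarith
  have hD : ∑ k ∈ Finset.range m, ((a (k + 2) - a (k + 1)) - (a (k + 1) - a k)) ^ 2
      ≤ (h * l) * (4 * K * E) := by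
    have h1 : ∀ k ∈ Finset.range m, ((a (k + 2) - a (k + 1)) - (a (k + 1) - a k)) ^ 2
        ≤ (h * l) * (2 * K * (boxInt x₀ (x₀ + h) (k * l) (k * l + l) (strainSq u v)
          + boxInt x₀ (x₀ + h) ((k + 1 : ℕ) * l) ((k + 1 : ℕ) * l + l) (strainSq u v))) :=
      fun k _ => by
        have h2 := hmean (k + 1)
        rw [hnode] at h2
        have h3 := mean_sub_mean_sq_le hK hh hl1 hl2 hu hv (hmean k) h2
        rw [hdiff k, hdiff (k + 1), hnode]
        calc _ = h * l * (h * l * (M (k + 1) - M k) ^ 2) := by ring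
          _ ≤ _ := mul_le_mul_of_nonneg_left h3 (by positivity)
    refine (Finset.sum_le_sum h1).trans ?_
    rw [← Finset.mul_sum, ← Finset.mul_sum, Finset.sum_add_distrib]
    refine mul_le_mul_of_nonneg_left ?_ (by positivity)
    have n : ∀ k : ℕ, 0 ≤ boxInt x₀ (x₀ + h) (k * l) (k * l + l) (strainSq u v) := fun k =>
      boxInt_nonneg (strainSq_nonneg u v)
    have s1 := Finset.sum_range_succ
      (fun k : ℕ => boxInt x₀ (x₀ + h) (k * l) (k * l + l) (strainSq u v)) m
    have s2 := Finset.sum_range_succ'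
      (fun k : ℕ => boxInt x₀ (x₀ + h) (k * l) (k * l + l) (strainSq u v)) m
    rw [← cells hE] at s1 s2
    have := n m
    have := n 0
    calc _ ≤ 2 * K * (E + E) := mul_le_mul_of_nonneg_left (by linarith) (by positivity)
      _ = _ := by ring
  have hNsum : N ≤ K * E + h * l * ∑ k ∈ Finset.range (m + 1), M k ^ 2 := by
    rw [hN, hEdef, cells (by fun_prop), cells hE, Finset.mul_sum, Finset.mul_sum,
      ← Finset.sum_add_distrib]
    refine Finset.sum_le_sum fun k _ => ?_
    obtain ⟨ω, hω⟩ := hK x₀ (k * l) h l hh hl (by linarith) (by linarith) u v hu hv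
    have hm' : boxInt x₀ (x₀ + h) (k * l) (k * l + l) (dy u)
        = (x₀ + h - x₀) * (k * l + l - k * l) * M k := by rw [hmean]; ring
    have h1 := boxInt_sub_const_sq hab (by linarith) hd (M k) ω hm'
    have h2 := boxInt_sub_const_sq hab (by linarith) hd (M k) 0 hm'
    simp only [sub_zero, add_sub_cancel_left] at h1 h2
    have : 0 ≤ h * l * (M k - ω) ^ 2 := by positivity
    linarith
  have hS : ∑ k ∈ Finset.range (m + 1), (a (k + 1) - a k) ^ 2
      = (h * l) * (h * l * ∑ k ∈ Finset.range (m + 1), M k ^ 2) := by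
    simp only [hdiff, mul_pow, ← Finset.mul_sum]
    ring
  rw [hS] at hdisc
  refine hNsum.trans (add_le_add_right ?_ _)
  have hD' : ∑ k ∈ Finset.range m, ((a (k + 2) - a (k + 1)) - (a (k + 1) - a k)) ^ 2
      ≤ h ^ 2 * (8 * K * E) := by
    refine hD.trans ?_
    have : 0 ≤ (2 * h - l) * (h * (4 * K * E)) := mul_nonneg (by linarith) (by positivity)
    nlinarith
  have hD2 := sqrt_le_sqrt hD'
  rw [sqrt_mul (sq_nonneg h), sqrt_sq hh.le] at hD2
  have hA2 := sqrt_le_sqrt hA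
  set R := h * l * ∑ k ∈ Finset.range (m + 1), M k ^ 2
  set P := √(2 * T + 8 * h ^ 2 * N)
  set Q := √(8 * K * E)
  have hfin : h * l * R ≤ 19 * P * (h * Q) :=
    hdisc.trans (mul_le_mul (mul_le_mul_of_nonneg_left hA2 (by norm_num)) hD2 (sqrt_nonneg _)
      (by positivity))
  have hhl : h * h * R ≤ h * l * R := by gcongr
  have e : 19 / h * P * Q = 19 * P * (h * Q) / (h * h) := by field_simp
  rw [e, le_div_iff₀ (by positivity)]
  linarith

/-- The case `α = 0` of the inequality. -/
lemma strip_bound : ∃ C : ℝ, 0 ≤ C ∧ ∀ (x₀ h p : ℝ) (u v : ℝ × ℝ → ℝ), 0 < h → 0 < p →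
    ContDiff ℝ (⊤ : ℕ∞) u → ContDiff ℝ (⊤ : ℕ∞) v →
    (∀ x ∈ Set.Icc x₀ (x₀ + h), u (x, 0) = u (x, p)) →
    boxInt x₀ (x₀ + h) 0 p (fun q => dy u q ^ 2)
      ≤ C * √(boxInt x₀ (x₀ + h) 0 p (strainSq u v))
        * (√(boxInt x₀ (x₀ + h) 0 p (fun q => u q ^ 2)) / h
          + √(boxInt x₀ (x₀ + h) 0 p (strainSq u v))) := by
  obtain ⟨K, hK0, hK⟩ := exists_isKornConst
  set L := 19 * √(8 * K) with hL
  have hL0 : 0 ≤ L := by positivity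
  refine ⟨2 * K + 4 * L + 9 * L ^ 2, by positivity, fun x₀ h p u v hh hp hu hv hper => ?_⟩
  have hE0 : 0 ≤ boxInt x₀ (x₀ + h) 0 p (strainSq u v) := boxInt_nonneg (strainSq_nonneg u v)
  have hN0 : 0 ≤ boxInt x₀ (x₀ + h) 0 p (fun q => dy u q ^ 2) := boxInt_nonneg fun _ => sq_nonneg _
  have hT0 : 0 ≤ boxInt x₀ (x₀ + h) 0 p (fun q => u q ^ 2) := boxInt_nonneg fun _ => sq_nonneg _
  have hflat := fun hph : p ≤ h => strip_flat hK hp hph hu hv hper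
  have htall := fun hhp : h ≤ p => strip_tall hK0 hK hh hhp hu hv hper
  set N := boxInt x₀ (x₀ + h) 0 p (fun q => dy u q ^ 2)
  rw [← sq_sqrt hE0] at hflat htall
  set e := √(boxInt x₀ (x₀ + h) 0 p (strainSq u v))
  set t := √(boxInt x₀ (x₀ + h) 0 p (fun q => u q ^ 2)) with ht
  have he : 0 ≤ e := sqrt_nonneg _
  have htn : 0 ≤ t := sqrt_nonneg _
  have hth : 0 ≤ e * (t / h) := by positivity
  rcases le_total p h with hph | hhp
  · have h1 := hflat hph
    have : 0 ≤ (K + 4 * L + 9 * L ^ 2) * e ^ 2 := by positivity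
    have : 0 ≤ (2 * K + 4 * L + 9 * L ^ 2) * (e * (t / h)) := by positivity
    linarith
  · have h1 := htall hhp
    have h2 : √(8 * K * e ^ 2) = √(8 * K) * e := by
      rw [sqrt_mul (by positivity), sqrt_sq he]
    have h3 : √(2 * boxInt x₀ (x₀ + h) 0 p (fun q => u q ^ 2) + 8 * h ^ 2 * N)
        ≤ 2 * t + 3 * (h * √N) := by
      refine (sqrt_le_left (by positivity)).2 ?_
      have e1 : t ^ 2 = boxInt x₀ (x₀ + h) 0 p (fun q => u q ^ 2) := sq_sqrt hT0
      have e2 : √N ^ 2 = N := sq_sqrt hN0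
      have e3 : 0 ≤ t * (h * √N) := by positivity
      nlinarith [sq_nonneg t, sq_nonneg (h * √N)]
    rw [h2] at h1
    have h4 : N ≤ K * e ^ 2 + L * e * (2 * (t / h) + 3 * √N) := by
      refine h1.trans (add_le_add_right ?_ _)
      calc _ ≤ 19 / h * (2 * t + 3 * (h * √N)) * (√(8 * K) * e) := by gcongr
        _ = _ := by rw [hL]; field_simp
    have e2 : √N ^ 2 = N := sq_sqrt hN0
    have h5 : 3 * (L * e) * √N ≤ N / 2 + 9 / 2 * (L * e) ^ 2 := by
      nlinarith [sq_nonneg (√N - 3 * (L * e))]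
    have h6 : N ≤ 2 * K * e ^ 2 + 4 * L * (e * (t / h)) + 9 * L ^ 2 * e ^ 2 := by
      nlinarith
    have : 0 ≤ 4 * L * e ^ 2 := by positivity
    have : 0 ≤ (2 * K + 9 * L ^ 2) * (e * (t / h)) := by positivity
    linarith

end StripTall

section MixedTerm

variable {u v : ℝ × ℝ → ℝ}

lemma contDiff_primitive {g : ℝ → ℝ} (hg : ContDiff ℝ (⊤ : ℕ∞) g) :
    ContDiff ℝ (⊤ : ℕ∞) (fun y => ∫ s in (0 : ℝ)..y, g s) := by
  have hd : ∀ y, HasDerivAt (fun y => ∫ s in (0 : ℝ)..y, g s) (g y) y := fun y =>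
    (hg.continuous.integral_hasStrictDerivAt 0 y).hasDerivAt
  refine contDiff_infty_iff_deriv.2 ⟨fun y => (hd y).differentiableAt, ?_⟩
  rwa [funext fun y => (hd y).deriv]

/-- Poincaré inequality in the first variable, relative to a fixed vertical segment. -/
lemma boxInt_sub_segment_sq_le {x₀ h p z : ℝ} (hh : 0 < h) (hp : 0 ≤ p)
    (hz : z ∈ Set.Icc x₀ (x₀ + h)) (hu : ContDiff ℝ (⊤ : ℕ∞) u) :
    boxInt x₀ (x₀ + h) 0 p (fun q => (u q - u (z, q.2)) ^ 2)
      ≤ h ^ 2 * boxInt x₀ (x₀ + h) 0 p (fun q => dx u q ^ 2) := by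
  have huc := hu.continuous
  have hd := (contDiff_dx hu).continuous
  have hab : x₀ ≤ x₀ + h := by linarith
  have hF : Continuous fun y => ∫ x in x₀..x₀ + h, dx u (x, y) ^ 2 :=
    continuous_integral_left (f := fun q => dx u q ^ 2) (by fun_prop) _ _
  have key : ∀ x ∈ Set.Icc x₀ (x₀ + h), ∀ y,
      (u (x, y) - u (z, y)) ^ 2 ≤ h * ∫ x in x₀..x₀ + h, dx u (x, y) ^ 2 := fun x hx y => by
    have hg : ∀ t, HasDerivAt (fun t => u (x₀ + h * t, y)) (h * dx u (x₀ + h * t, y)) t :=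
      fun t => by
        have h0 := (hasDerivAt_dx hu (x₀ + h * t) y).comp t
          (((hasDerivAt_id t).const_mul h).const_add x₀)
        exact h0.congr_deriv (by simp [mul_comm])
    have mem : ∀ x ∈ Set.Icc x₀ (x₀ + h), (x - x₀) / h ∈ Set.Icc (0 : ℝ) 1 := fun x hx =>
      ⟨div_nonneg (by linarith [hx.1]) hh.le, (div_le_one hh).2 (by linarith [hx.2])⟩
    have back : ∀ x, x₀ + h * ((x - x₀) / h) = x := fun x => by field_simp; ring
    have h1 := sq_sub_le_integral hg (by fun_prop) (mem z hz) (mem x hx)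
    simp only [back, mul_pow, intervalIntegral.integral_const_mul] at h1
    rw [intervalIntegral.integral_comp_add_mul (fun x => dx u (x, y) ^ 2) hh.ne'] at h1
    simp only [mul_zero, add_zero, mul_one, smul_eq_mul] at h1
    refine h1.trans_eq ?_
    field_simp
  calc _ ≤ boxInt x₀ (x₀ + h) 0 p (fun q => h * ∫ x in x₀..x₀ + h, dx u (x, q.2) ^ 2) :=
        boxInt_mono (by fun_prop) (by fun_prop) fun x hx y _ => key x hx y
    _ = _ := by
        rw [boxInt_const_mul, boxInt_eq' hab hp (by fun_prop), boxInt_eq' hab hp (by fun_prop)]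
        simp only [intervalIntegral.integral_const, smul_eq_mul, add_sub_cancel_left,
          intervalIntegral.integral_const_mul]
        ring

/-- Absorbing the mixed term into the second component changes the strain by a bounded factor. -/
lemma exists_strainSq_le {x₀ h p z α : ℝ} (hh : 0 < h) (hh1 : h < 1) (hp : 0 ≤ p)
    (hα : α ∈ Set.Icc (-1 : ℝ) 1) (hz : z ∈ Set.Icc x₀ (x₀ + h))
    (hu : ContDiff ℝ (⊤ : ℕ∞) u) (hv : ContDiff ℝ (⊤ : ℕ∞) v) :
    ∃ V : ℝ × ℝ → ℝ, ContDiff ℝ (⊤ : ℕ∞) V ∧ boxInt x₀ (x₀ + h) 0 p (strainSq u V)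
      ≤ 4 * boxInt x₀ (x₀ + h) 0 p
        (fun q => dx u q ^ 2 + 2 * ((dy u q + dx v q) / 2) ^ 2 + (dy v q + α * u q) ^ 2) := by
  have huc := hu.continuous
  have hvc := hv.continuous
  have hux := (contDiff_dx hu).continuous
  have huy := (contDiff_dy hu).continuous
  have hvx := (contDiff_dx hv).continuous
  have hvy := (contDiff_dy hv).continuous
  have hgs : ContDiff ℝ (⊤ : ℕ∞) (fun s => u (z, s)) := by fun_prop
  have hG := contDiff_primitive hgs
  have hGd : ∀ y, HasDerivAt (fun y => ∫ s in (0 : ℝ)..y, u (z, s)) (u (z, y)) y := fun y =>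
    (hgs.continuous.integral_hasStrictDerivAt 0 y).hasDerivAt
  set G : ℝ → ℝ := fun y => ∫ s in (0 : ℝ)..y, u (z, s)
  have hV : ContDiff ℝ (⊤ : ℕ∞) (fun q : ℝ × ℝ => v q + α * G q.2) := by fun_prop
  have hVx : ∀ x y, dx (fun q => v q + α * G q.2) (x, y) = dx v (x, y) := fun x y =>
    dx_eq_of_hasDerivAt hV ((hasDerivAt_dx hv x y).add_const (α * G y))
  have hVy : ∀ x y, dy (fun q => v q + α * G q.2) (x, y) = dy v (x, y) + α * u (z, y) :=
    fun x y => dy_eq_of_hasDerivAt hV ((hasDerivAt_dy hv x y).add ((hGd y).const_mul α))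
  refine ⟨_, hV, ?_⟩
  have hα2 : α ^ 2 ≤ 1 := by nlinarith [hα.1, hα.2]
  have h1 : boxInt x₀ (x₀ + h) 0 p (strainSq u (fun q => v q + α * G q.2))
      ≤ boxInt x₀ (x₀ + h) 0 p (fun q => 2 * (dx u q ^ 2 + 2 * ((dy u q + dx v q) / 2) ^ 2
          + (dy v q + α * u q) ^ 2) + 2 * (u q - u (z, q.2)) ^ 2) := by
    refine boxInt_mono (continuous_strainSq hu hV) (by fun_prop) fun x _ y _ => ?_
    unfold strainSq
    rw [hVx, hVy]
    have e1 := mul_le_mul_of_nonneg_right hα2 (sq_nonneg (u (x, y) - u (z, y)))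
    have e2 : dy v (x, y) + α * u (z, y)
        = (dy v (x, y) + α * u (x, y)) - α * (u (x, y) - u (z, y)) := by ring
    rw [e2]
    set r := dy v (x, y) + α * u (x, y)
    set s := u (x, y) - u (z, y)
    nlinarith [sq_nonneg (r + α * s), sq_nonneg (dx u (x, y))]
  have h2 : boxInt x₀ (x₀ + h) 0 p (fun q => dx u q ^ 2) ≤ boxInt x₀ (x₀ + h) 0 p
      (fun q => dx u q ^ 2 + 2 * ((dy u q + dx v q) / 2) ^ 2 + (dy v q + α * u q) ^ 2) :=
    boxInt_mono (by fun_prop) (by fun_prop) fun x _ y _ => by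
      rw [add_assoc]
      exact le_add_of_nonneg_right (by positivity)
  have h3 := boxInt_sub_segment_sq_le hh hp hz hu
  have h4 : h ^ 2 * boxInt x₀ (x₀ + h) 0 p (fun q => dx u q ^ 2)
      ≤ boxInt x₀ (x₀ + h) 0 p (fun q => dx u q ^ 2) :=
    mul_le_of_le_one_left (boxInt_nonneg fun _ => sq_nonneg _) (by nlinarith)
  rw [boxInt_add (by fun_prop) (by fun_prop), boxInt_const_mul, boxInt_const_mul] at h1
  linarith

lemma boxInt_gradient_sq_le {x₀ h p α : ℝ}
    (hu : ContDiff ℝ (⊤ : ℕ∞) u) (hv : ContDiff ℝ (⊤ : ℕ∞) v) :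
    boxInt x₀ (x₀ + h) 0 p
        (fun q => dx u q ^ 2 + dy u q ^ 2 + dx v q ^ 2 + (dy v q + α * u q) ^ 2)
      ≤ 4 * boxInt x₀ (x₀ + h) 0 p
          (fun q => dx u q ^ 2 + 2 * ((dy u q + dx v q) / 2) ^ 2 + (dy v q + α * u q) ^ 2)
        + 3 * boxInt x₀ (x₀ + h) 0 p (fun q => dy u q ^ 2) := by
  have huc := hu.continuous
  have hux := (contDiff_dx hu).continuous
  have huy := (contDiff_dy hu).continuous
  have hvx := (contDiff_dx hv).continuous
  have hvy := (contDiff_dy hv).continuous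
  rw [← boxInt_const_mul, ← boxInt_const_mul, ← boxInt_add (by fun_prop) (by fun_prop)]
  refine boxInt_mono (by fun_prop) (by fun_prop) fun x _ y _ => ?_
  nlinarith [sq_nonneg (dx v (x, y) + 2 * dy u (x, y)), sq_nonneg (dx u (x, y)),
    sq_nonneg (dy v (x, y) + α * u (x, y))]

end MixedTerm

/-- Auxiliary 2D Korn-type inequality with mixed term (Lemma 4.1), with C₀ = 100. -/
theorem korn_mixed_term :
    ∃ C₀ : ℝ, 0 < C₀ ∧ ∀ p h α : ℝ, 0 < p → 0 < h → h < 1 →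
      α ∈ Set.Icc (-1:ℝ) 1 →
      ∀ u v : ℝ × ℝ → ℝ, ContDiff ℝ (⊤ : ℕ∞) u → ContDiff ℝ (⊤ : ℕ∞) v →
      (∀ x ∈ Ih h, u (x, 0) = u (x, p)) →
      (∫ q in rect h p,
          ((dx u q)^2 + (dy u q)^2 + (dx v q)^2 + (dy v q + α * u q)^2))
        ≤ C₀ * Real.sqrt (∫ q in rect h p,
              ((dx u q)^2 + 2*((dy u q + dx v q)/2)^2 + (dy v q + α * u q)^2)) *
            (Real.sqrt (∫ q in rect h p, (u q)^2) / h
              + Real.sqrt (∫ q in rect h p,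
                  ((dx u q)^2 + 2*((dy u q + dx v q)/2)^2 + (dy v q + α * u q)^2))) := by
  obtain ⟨C, hC0, hC⟩ := strip_bound
  refine ⟨4 + 12 * C, by positivity, fun p h α hp hh hh1 hα u v hu hv hper => ?_⟩
  have hI : 1 + h / 2 = 1 - h / 2 + h := by ring
  simp only [rect, Ih, hI] at hper ⊢
  change boxInt _ _ 0 p _ ≤ _ * √(boxInt _ _ 0 p _) * (√(boxInt _ _ 0 p _) / h
    + √(boxInt _ _ 0 p _))
  obtain ⟨V, hV, hVE⟩ := exists_strainSq_le (x₀ := 1 - h / 2) (z := 1) hh hh1 hp.le hα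
    ⟨by linarith, by linarith⟩ hu hv
  have h1 := hC _ h p u V hh hp hu hV hper
  refine (boxInt_gradient_sq_le hu hv).trans ?_
  set E := boxInt (1 - h / 2) (1 - h / 2 + h) 0 p
    (fun q => dx u q ^ 2 + 2 * ((dy u q + dx v q) / 2) ^ 2 + (dy v q + α * u q) ^ 2) with hE
  have hE0 : 0 ≤ E := boxInt_nonneg fun _ => by positivity
  have h2 := sqrt_le_sqrt hVE
  rw [sqrt_mul (by norm_num), show (4 : ℝ) = 2 ^ 2 by norm_num, sqrt_sq (by norm_num)] at h2
  set t := √(boxInt (1 - h / 2) (1 - h / 2 + h) 0 p (fun q => u q ^ 2))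
  have ht : 0 ≤ t / h := div_nonneg (sqrt_nonneg _) hh.le
  have hEE : √E ^ 2 = E := sq_sqrt hE0
  set e := √E
  have he : 0 ≤ e := sqrt_nonneg _
  have h3 : boxInt (1 - h / 2) (1 - h / 2 + h) 0 p (fun q => dy u q ^ 2)
      ≤ C * (2 * e) * (t / h + 2 * e) := h1.trans (by gcongr)
  have h4 : 0 ≤ e * (t / h) := by positivity
  have h5 : 0 ≤ C * (e * (t / h)) := by positivity
  nlinarith
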